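/- arXiv:2007.05458 — 2 statements merged into one kernel-verified Lean document; each statement's English description precedes it below -/
import Mathlib

section
/- Let n₁, n₂, n₃ ≥ 1 and M ≥ 1 be integers such that the independence condition holds for (n₁, n₂, n₃, M). Let T₁ = Σ_{i₁=0}^{n₁} Σ_{i₂=0}^{n₂} Σ_{i₃=0}^{n₃} e_{i₁} ⊗ e_{i₂} ⊗ e_{i₃} ⊗ e_{(i₁,i₂,i₃)} ∈ ℂ^{n₁+1} ⊗ ℂ^{n₂+1} ⊗ ℂ^{n₃+1} ⊗ ℂ^{(n₁+1)(n₂+1)(n₃+1)} and let T₂ = Σ_{ℓ=1}^{M} e_ℓ ⊗ e_ℓ ⊗ e_ℓ ⊗ e₀ ∈ ℂ^M ⊗ ℂ^M ⊗ ℂ^M ⊗ ℂ¹. Then R̲(T₁) = (n₁+1)(n₂+1)(n₃+1), R̲(T₂) = M, and R̲(T₁ ⊕ T₂) = (n₁+1)(n₂+1)(n₃+1) + 1. -/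
open Finset

namespace Subadditivity

noncomputable section

/-- A tensor of order `k` over `ℂ` with `i`-th factor the space `ℂ^{ι i}` of complex-valued
functions on the finite index type `ι i`; the tensor is represented by the array of its
coordinates with respect to the standard basis, i.e. by an element of
`ℂ^{ι 0} ⊗ ⋯ ⊗ ℂ^{ι (k-1)} ≃ ((∀ i, ι i) → ℂ)`. -/
abbrev Tensor {k : ℕ} (ι : Fin k → Type) : Type := (∀ i, ι i) → ℂ

/-- `T` is a sum of `r` simple (rank-one) tensors `v j 0 ⊗ ⋯ ⊗ v j (k-1)`. -/
def HasRankLE {k : ℕ} {ι : Fin k → Type} (T : Tensor ι) (r : ℕ) : Prop :=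
  ∃ v : Fin r → (∀ i, ι i → ℂ), T = fun x => ∑ j : Fin r, ∏ i : Fin k, v j i (x i)

/-- Tensor rank: the least `r` such that `T` is a sum of `r` simple tensors. -/
noncomputable def rank {k : ℕ} {ι : Fin k → Type} (T : Tensor ι) : ℕ :=
  sInf {r | HasRankLE T r}

/-- Border rank is at most `r`: `T` lies in the closure of the set of tensors of rank `≤ r`. -/
def HasBorderRankLE {k : ℕ} {ι : Fin k → Type} (T : Tensor ι) (r : ℕ) : Prop :=
  T ∈ closure {S : Tensor ι | HasRankLE S r}

/-- Border rank. -/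
noncomputable def borderRank {k : ℕ} {ι : Fin k → Type} (T : Tensor ι) : ℕ :=
  sInf {r | HasBorderRankLE T r}

open scoped Classical in
/-- Direct sum of two tensors of order `k`: the coordinates supported on the `ι`-part are
those of `T`, the coordinates supported on the `κ`-part are those of `S`, and all mixed
coordinates vanish. -/
noncomputable def dsum {k : ℕ} {ι κ : Fin k → Type} (T : Tensor ι) (S : Tensor κ) :
    Tensor (fun i => ι i ⊕ κ i) := fun x =>
  (if h : ∃ y : ∀ i, ι i, x = fun i => Sum.inl (y i) then T h.choose else 0) +
  (if h : ∃ z : ∀ i, κ i, x = fun i => Sum.inr (z i) then S h.choose else 0)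

/-- Kronecker product of two tensors of order `k`. -/
def kron {k : ℕ} {ι κ : Fin k → Type} (T : Tensor ι) (S : Tensor κ) :
    Tensor (fun i => ι i × κ i) := fun x =>
  T (fun i => (x i).1) * S (fun i => (x i).2)

/-- `N`-th Kronecker power of a tensor of order `k`. -/
def kpow {k : ℕ} {ι : Fin k → Type} (T : Tensor ι) (N : ℕ) :
    Tensor (fun i => Fin N → ι i) := fun x => ∏ j : Fin N, T (fun i => x i j)

/-- The unit tensor `u_k(r) = Σ_{j=1}^r e_j ⊗ ⋯ ⊗ e_j` of order `k`. -/
def unit (k r : ℕ) : Tensor (fun _ : Fin k => Fin r) := fun x =>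
  ∑ j : Fin r, ∏ i : Fin k, (if x i = j then (1 : ℂ) else 0)

/-- `S` is a degeneration of `T`: `S` lies in the closure of the set of tensors obtained
from `T` by applying linear maps `A i` on each factor. -/
def Degen {k : ℕ} {ι κ : Fin k → Type} [∀ i, Fintype (κ i)]
    (S : Tensor ι) (T : Tensor κ) : Prop :=
  S ∈ closure {S' : Tensor ι | ∃ A : ∀ i, ι i → κ i → ℂ,
    S' = fun x => ∑ y : ∀ i, κ i, (∏ i : Fin k, A i (x i) (y i)) * T y}

/-- Kronecker delta. -/
def delta {α : Type} [DecidableEq α] (a b : α) : ℂ := if a = b then 1 else 0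

/-- The order-4 "spider" tensor
`Σ_{i₁,i₂,i₃} e_{i₁} ⊗ e_{i₂} ⊗ e_{i₃} ⊗ e_{(i₁,i₂,i₃)} ∈ ℂ^{m₁} ⊗ ℂ^{m₂} ⊗ ℂ^{m₃} ⊗ ℂ^{m₁m₂m₃}`,
the last factor being indexed by triples. -/
def spider3 (m₁ m₂ m₃ : ℕ) :
    Tensor ![Fin m₁, Fin m₂, Fin m₃, Fin m₁ × Fin m₂ × Fin m₃] := fun x =>
  delta (α := Fin m₁ × Fin m₂ × Fin m₃) (x 3) (x 0, x 1, x 2)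

/-- The order-4 tensor `Σ_{j=1}^N e_j ⊗ e_j ⊗ e₀ ⊗ e₀ ∈ ℂ^N ⊗ ℂ^N ⊗ ℂ¹ ⊗ ℂ¹`. -/
def matTensor4 (N : ℕ) : Tensor ![Fin N, Fin N, Fin 1, Fin 1] := fun x =>
  delta (α := Fin N) (x 0) (x 1)

/-- The order-4 tensor `Σ_{ℓ=1}^M e_ℓ ⊗ e_ℓ ⊗ e_ℓ ⊗ e₀ ∈ ℂ^M ⊗ ℂ^M ⊗ ℂ^M ⊗ ℂ¹`. -/
def ghz4 (M : ℕ) : Tensor ![Fin M, Fin M, Fin M, Fin 1] := fun x =>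
  delta (α := Fin M) (x 0) (x 1) * delta (α := Fin M) (x 1) (x 2)

/-- The combinatorial independence condition of Construction 4: there exist pairwise
disjoint subsets `J, K₁, K₂, K₃` of `[n₁] × [n₂] × [n₃]`, each of cardinality `M`,
together with bijections `s_i : J → K_i` such that `s_i` fixes the `i`-th coordinate. -/
def IndepCond (n₁ n₂ n₃ M : ℕ) : Prop :=
  ∃ (J K₁ K₂ K₃ : Finset (Fin n₁ × Fin n₂ × Fin n₃))
    (s₁ s₂ s₃ : Fin n₁ × Fin n₂ × Fin n₃ → Fin n₁ × Fin n₂ × Fin n₃),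
    J.card = M ∧ K₁.card = M ∧ K₂.card = M ∧ K₃.card = M ∧
    Disjoint J K₁ ∧ Disjoint J K₂ ∧ Disjoint J K₃ ∧
    Disjoint K₁ K₂ ∧ Disjoint K₁ K₃ ∧ Disjoint K₂ K₃ ∧
    Set.BijOn s₁ ↑J ↑K₁ ∧ Set.BijOn s₂ ↑J ↑K₂ ∧ Set.BijOn s₃ ↑J ↑K₃ ∧
    (∀ x ∈ J, (s₁ x).1 = x.1) ∧
    (∀ x ∈ J, (s₂ x).2.1 = x.2.1) ∧
    (∀ x ∈ J, (s₃ x).2.2 = x.2.2)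

/-! ### Lower bounds by flattenings -/

/-- If a flattening of `T` along the factor `i₀` contains an identity submatrix indexed by `α`,
then the border rank of `T` is at least the cardinality of `α`. -/
theorem HasBorderRankLE.card_le {k : ℕ} {ι : Fin k → Type} {T : Tensor ι} {r : ℕ}
    (hT : HasBorderRankLE T r) {α : Type} [Fintype α] [DecidableEq α] (i₀ : Fin k)
    (y : α → ∀ i, ι i)
    (hy : ∀ s t, T (Function.update (y t) i₀ (y s i₀)) = if s = t then 1 else 0) :
    Fintype.card α ≤ r := by
  by_contra! hlt
  let F : Tensor ι → ℂ := fun S =>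
    (Matrix.of fun s t => S (Function.update (y t) i₀ (y s i₀)) : Matrix α α ℂ).det
  have hF : Continuous F := by
    apply Continuous.matrix_det
    refine continuous_matrix fun s t => ?_
    exact continuous_apply _
  have hsub : {S : Tensor ι | HasRankLE S r} ⊆ F ⁻¹' {0} := by
    rintro S ⟨v, rfl⟩
    have hfac : (Matrix.of fun s t => ∑ j : Fin r, ∏ i : Fin k,
        v j i (Function.update (y t) i₀ (y s i₀) i) : Matrix α α ℂ) =
        (Matrix.of fun s j => v j i₀ (y s i₀) : Matrix α (Fin r) ℂ) *
        (Matrix.of fun j t => ∏ i ∈ univ.erase i₀, v j i (y t i) : Matrix (Fin r) α ℂ) := by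
      ext s t
      simp only [Matrix.mul_apply, Matrix.of_apply]
      refine Finset.sum_congr rfl fun j _ => ?_
      rw [← Finset.mul_prod_erase univ _ (Finset.mem_univ i₀), Function.update_self]
      congr 1
      refine Finset.prod_congr rfl fun i hi => ?_
      rw [Function.update_of_ne (Finset.ne_of_mem_erase hi)]
    simp only [Set.mem_preimage, Set.mem_singleton_iff, F]
    rw [hfac]
    by_contra hne
    have hrk := Matrix.rank_of_isUnit _ ((Matrix.isUnit_iff_isUnit_det _).2 (Ne.isUnit hne))
    have hle := hrk.symm.trans_le ((Matrix.rank_mul_le_left _ _).trans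
      (Matrix.rank_le_card_width _))
    rw [Fintype.card_fin] at hle
    exact absurd hle (not_le.2 hlt)
  have hmem : F T = 0 :=
    closure_minimal hsub (isClosed_singleton.preimage hF) hT
  have hone : F T = 1 := by
    have : (Matrix.of fun s t => T (Function.update (y t) i₀ (y s i₀)) : Matrix α α ℂ) = 1 := by
      ext s t
      simp [hy, Matrix.one_apply]
    simp only [F, this, Matrix.det_one]
  exact one_ne_zero (hone.symm.trans hmem)

theorem borderRank_eq {k : ℕ} {ι : Fin k → Type} {T : Tensor ι} {r : ℕ}
    (hle : HasBorderRankLE T r) (hge : ∀ s, HasBorderRankLE T s → r ≤ s) :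
    borderRank T = r :=
  le_antisymm (Nat.sInf_le hle) (le_csInf ⟨r, hle⟩ fun s hs => hge s hs)

/-! ### Upper bounds -/

theorem hasRankLE_of_sum {k : ℕ} {ι : Fin k → Type} {T : Tensor ι} {r : ℕ} {α : Type} [Fintype α]
    (hα : Fintype.card α = r) (v : α → ∀ i, ι i → ℂ)
    (hT : ∀ x, T x = ∑ j : α, ∏ i : Fin k, v j i (x i)) : HasRankLE T r := by
  refine ⟨fun j => v ((Fintype.equivFinOfCardEq hα).symm j), funext fun x => ?_⟩
  rw [hT, ← (Fintype.equivFinOfCardEq hα).symm.sum_comp]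

theorem HasRankLE.hasBorderRankLE {k : ℕ} {ι : Fin k → Type} {T : Tensor ι} {r : ℕ}
    (hT : HasRankLE T r) : HasBorderRankLE T r :=
  subset_closure hT

/-- A dependent quadruple, as a family over `Fin 4`. -/
def quad {β : Fin 4 → Type} (a : β 0) (b : β 1) (c : β 2) (d : β 3) : ∀ i, β i
  | 0 => a
  | 1 => b
  | 2 => c
  | 3 => d

theorem eq_quad {β : Fin 4 → Type} (x : ∀ i, β i) : x = quad (x 0) (x 1) (x 2) (x 3) := by
  funext i
  fin_cases i <;> rfl

/-! ### Evaluation of direct sums -/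

theorem dsum_inl {k : ℕ} [NeZero k] {ι κ : Fin k → Type} (T : Tensor ι) (S : Tensor κ)
    (x : ∀ i, ι i ⊕ κ i) (y : ∀ i, ι i) (hx : ∀ i, x i = Sum.inl (y i)) : dsum T S x = T y := by
  obtain rfl : x = fun i => Sum.inl (y i) := funext hx
  have h : ∃ y' : ∀ i, ι i, (fun i => (Sum.inl (y i) : ι i ⊕ κ i)) = fun i => Sum.inl (y' i) :=
    ⟨y, rfl⟩
  have h' : ¬ ∃ z : ∀ i, κ i, (fun i => (Sum.inl (y i) : ι i ⊕ κ i)) = fun i => Sum.inr (z i) :=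
    fun ⟨z, hz⟩ => Sum.inl_ne_inr (congrFun hz 0)
  have hc : h.choose = y := funext fun i => (Sum.inl_injective (congrFun h.choose_spec i)).symm
  unfold dsum
  rw [dif_pos h, dif_neg h', hc, add_zero]

theorem dsum_inr {k : ℕ} [NeZero k] {ι κ : Fin k → Type} (T : Tensor ι) (S : Tensor κ)
    (x : ∀ i, ι i ⊕ κ i) (z : ∀ i, κ i) (hx : ∀ i, x i = Sum.inr (z i)) : dsum T S x = S z := by
  obtain rfl : x = fun i => Sum.inr (z i) := funext hx
  have h : ∃ z' : ∀ i, κ i, (fun i => (Sum.inr (z i) : ι i ⊕ κ i)) = fun i => Sum.inr (z' i) :=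
    ⟨z, rfl⟩
  have h' : ¬ ∃ y : ∀ i, ι i, (fun i => (Sum.inr (z i) : ι i ⊕ κ i)) = fun i => Sum.inl (y i) :=
    fun ⟨y, hy⟩ => Sum.inr_ne_inl (congrFun hy 0)
  have hc : h.choose = z := funext fun i => (Sum.inr_injective (congrFun h.choose_spec i)).symm
  unfold dsum
  rw [dif_neg h', dif_pos h, hc, zero_add]

theorem dsum_mixed {k : ℕ} {ι κ : Fin k → Type} (T : Tensor ι) (S : Tensor κ)
    (x : ∀ i, ι i ⊕ κ i) {i j : Fin k} {a : ι i} {b : κ j} (hi : x i = Sum.inl a)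
    (hj : x j = Sum.inr b) : dsum T S x = 0 := by
  have h : ¬ ∃ y : ∀ i, ι i, x = fun i => Sum.inl (y i) :=
    fun ⟨y, hy⟩ => Sum.inr_ne_inl (hj.symm.trans (congrFun hy j))
  have h' : ¬ ∃ z : ∀ i, κ i, x = fun i => Sum.inr (z i) :=
    fun ⟨z, hz⟩ => Sum.inl_ne_inr (hi.symm.trans (congrFun hz i))
  unfold dsum
  rw [dif_neg h, dif_neg h', add_zero]

/-! ### The correction vectors -/

theorem sum_delta_mul {α : Type} [Fintype α] [DecidableEq α] (a : α) (F : α → ℂ) :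
    ∑ i, delta i a * F i = F a := by
  simp [delta]

theorem sum_delta_prod {α β γ : Type} [Fintype α] [Fintype β] [Fintype γ] [DecidableEq α]
    [DecidableEq β] [DecidableEq γ] (a : α) (b : β) (c : γ) (t : α × β × γ) :
    ∑ i : α × β × γ, delta i.1 a * delta i.2.1 b * delta i.2.2 c * delta i t =
      delta t (a, b, c) := by
  simp_rw [mul_comm _ (delta _ t), sum_delta_mul]
  simp only [delta, Prod.ext_iff]
  split_ifs <;> simp_all

theorem delta_mul_delta {α : Type} [DecidableEq α] (p q r : α) :
    delta p q * delta p r = delta p q * delta q r := by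
  by_cases h : p = q <;> simp [delta, h]

theorem sum_delta_cube {α : Type} [Fintype α] [DecidableEq α] (p q r : α) :
    ∑ i, delta i p * delta i q * delta i r * 1 = delta p q * delta q r := by
  simp_rw [mul_one, mul_assoc, sum_delta_mul]
  exact delta_mul_delta p q r

/-- Vectors on the box `[n₁] × [n₂] × [n₃]` whose triple products sum to the unit tensor, while
the double products cancel on each slice. -/
theorem IndepCond.exists_core {n₁ n₂ n₃ M : ℕ} (hind : IndepCond n₁ n₂ n₃ M) :
    ∃ u v w : Fin n₁ × Fin n₂ × Fin n₃ → Fin M → ℂ,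
      (∀ (g : Fin n₃ → ℂ) p q, ∑ i, u i p * v i q * g i.2.2 = 0) ∧
      (∀ (g : Fin n₂ → ℂ) p q, ∑ i, u i p * w i q * g i.2.1 = 0) ∧
      (∀ (g : Fin n₁ → ℂ) p q, ∑ i, v i p * w i q * g i.1 = 0) ∧
      (∀ p q r, ∑ i, u i p * v i q * w i r = delta p q * delta q r) := by
  obtain ⟨J, K₁, K₂, K₃, s₁, s₂, s₃, hJ, -, -, -, d1, d2, d3, d12, d13, d23, b1, b2, b3,
    f1, f2, f3⟩ := hind
  let e := (Finset.equivFinOfCardEq hJ).symm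
  let a : Fin M → Fin n₁ × Fin n₂ × Fin n₃ := fun p => (e p).1
  have ha : ∀ p, a p ∈ J := fun p => (e p).2
  have inj : ∀ {p q}, a p = a q ↔ p = q := fun {p q} =>
    ⟨fun h => e.injective (Subtype.ext h), fun h => h ▸ rfl⟩
  have m1 : ∀ p, s₁ (a p) ∈ K₁ := fun p => b1.mapsTo (ha p)
  have m2 : ∀ p, s₂ (a p) ∈ K₂ := fun p => b2.mapsTo (ha p)
  have m3 : ∀ p, s₃ (a p) ∈ K₃ := fun p => b3.mapsTo (ha p)
  have i1 : ∀ {p q}, s₁ (a p) = s₁ (a q) ↔ p = q := fun {p q} =>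
    (b1.injOn.eq_iff (ha p) (ha q)).trans inj
  have i2 : ∀ {p q}, s₂ (a p) = s₂ (a q) ↔ p = q := fun {p q} =>
    (b2.injOn.eq_iff (ha p) (ha q)).trans inj
  have i3 : ∀ {p q}, s₃ (a p) = s₃ (a q) ↔ p = q := fun {p q} =>
    (b3.injOn.eq_iff (ha p) (ha q)).trans inj
  have n1 : ∀ p q, a p ≠ s₁ (a q) := fun p q => Finset.disjoint_iff_ne.1 d1 _ (ha p) _ (m1 q)
  have n2 : ∀ p q, a p ≠ s₂ (a q) := fun p q => Finset.disjoint_iff_ne.1 d2 _ (ha p) _ (m2 q)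
  have n3 : ∀ p q, a p ≠ s₃ (a q) := fun p q => Finset.disjoint_iff_ne.1 d3 _ (ha p) _ (m3 q)
  have n12 : ∀ p q, s₁ (a p) ≠ s₂ (a q) :=
    fun p q => Finset.disjoint_iff_ne.1 d12 _ (m1 p) _ (m2 q)
  have n13 : ∀ p q, s₁ (a p) ≠ s₃ (a q) :=
    fun p q => Finset.disjoint_iff_ne.1 d13 _ (m1 p) _ (m3 q)
  have n23 : ∀ p q, s₂ (a p) ≠ s₃ (a q) :=
    fun p q => Finset.disjoint_iff_ne.1 d23 _ (m2 p) _ (m3 q)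
  let u : Fin n₁ × Fin n₂ × Fin n₃ → Fin M → ℂ :=
    fun i p => delta i (a p) + delta i (s₃ (a p)) + delta i (s₂ (a p))
  let v : Fin n₁ × Fin n₂ × Fin n₃ → Fin M → ℂ :=
    fun i p => delta i (a p) - delta i (s₃ (a p)) + delta i (s₁ (a p))
  let w : Fin n₁ × Fin n₂ × Fin n₃ → Fin M → ℂ :=
    fun i p => delta i (a p) - delta i (s₂ (a p)) - delta i (s₁ (a p))
  have hu : ∀ p (F : Fin n₁ × Fin n₂ × Fin n₃ → ℂ),
      ∑ i, u i p * F i = F (a p) + F (s₃ (a p)) + F (s₂ (a p)) := fun p F => by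
    simp only [u, add_mul, Finset.sum_add_distrib, sum_delta_mul]
  have hv : ∀ p (F : Fin n₁ × Fin n₂ × Fin n₃ → ℂ),
      ∑ i, v i p * F i = F (a p) - F (s₃ (a p)) + F (s₁ (a p)) := fun p F => by
    simp only [v, add_mul, sub_mul, Finset.sum_add_distrib, Finset.sum_sub_distrib, sum_delta_mul]
  have va : ∀ p q, v (a p) q = delta p q := fun p q => by
    simp [v, delta, inj, n1, n3]
  have v3 : ∀ p q, v (s₃ (a p)) q = -delta p q := fun p q => by
    simp [v, delta, i3, (n3 _ _).symm, (n13 _ _).symm]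
  have v2 : ∀ p q, v (s₂ (a p)) q = 0 := fun p q => by
    simp [v, delta, (n2 _ _).symm, (n12 _ _).symm, n23]
  have wa : ∀ p q, w (a p) q = delta p q := fun p q => by
    simp [w, delta, inj, n1, n2]
  have w3 : ∀ p q, w (s₃ (a p)) q = 0 := fun p q => by
    simp [w, delta, (n3 _ _).symm, (n13 _ _).symm, (n23 _ _).symm]
  have w2 : ∀ p q, w (s₂ (a p)) q = -delta p q := fun p q => by
    simp [w, delta, i2, (n2 _ _).symm, (n12 _ _).symm]
  have w1 : ∀ p q, w (s₁ (a p)) q = -delta p q := fun p q => by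
    simp [w, delta, i1, (n1 _ _).symm, n12]
  refine ⟨u, v, w, fun g p q => ?_, fun g p q => ?_, fun g p q => ?_, fun p q r => ?_⟩
  · simp only [mul_assoc, hu, va, v3, v2, f3 _ (ha p)]; ring
  · simp only [mul_assoc, hu, wa, w3, w2, f2 _ (ha p)]; ring
  · simp only [mul_assoc, hv, wa, w3, w1, f1 _ (ha p)]; ring
  · simp only [mul_assoc, hu, va, v3, v2, wa, w3]
    linear_combination delta_mul_delta p q r

/-- Extension of the core vectors to the box `{0,…,n₁} × {0,…,n₂} × {0,…,n₃}` for which moreover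
the single vectors cancel on each line in the respective direction. -/
theorem IndepCond.exists_extension {n₁ n₂ n₃ M : ℕ} (hind : IndepCond n₁ n₂ n₃ M) :
    ∃ u v w : Fin (n₁ + 1) × Fin (n₂ + 1) × Fin (n₃ + 1) → Fin M → ℂ,
      (∀ (g : Fin (n₂ + 1) → Fin (n₃ + 1) → ℂ) p, ∑ i, u i p * g i.2.1 i.2.2 = 0) ∧
      (∀ (g : Fin (n₁ + 1) → Fin (n₃ + 1) → ℂ) p, ∑ i, v i p * g i.1 i.2.2 = 0) ∧
      (∀ (g : Fin (n₁ + 1) → Fin (n₂ + 1) → ℂ) p, ∑ i, w i p * g i.1 i.2.1 = 0) ∧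
      (∀ (g : Fin (n₃ + 1) → ℂ) p q, ∑ i, u i p * v i q * g i.2.2 = 0) ∧
      (∀ (g : Fin (n₂ + 1) → ℂ) p q, ∑ i, u i p * w i q * g i.2.1 = 0) ∧
      (∀ (g : Fin (n₁ + 1) → ℂ) p q, ∑ i, v i p * w i q * g i.1 = 0) ∧
      (∀ p q r, ∑ i, u i p * v i q * w i r = delta p q * delta q r) := by
  obtain ⟨u, v, w, huv, huw, hvw, huvw⟩ := hind.exists_core
  refine ⟨
    fun i p => Fin.cases (Fin.cases 0 (fun j => Fin.cases 0 (fun k => -∑ l, u (l, j, k) p) i.2.2)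
      i.2.1) (fun l => Fin.cases 0 (fun j => Fin.cases 0 (fun k => u (l, j, k) p) i.2.2) i.2.1) i.1,
    fun i p => Fin.cases (Fin.cases 0 (fun j => Fin.cases 0 (fun k => -∑ l, v (j, l, k) p) i.2.2)
      i.1) (fun l => Fin.cases 0 (fun j => Fin.cases 0 (fun k => v (j, l, k) p) i.2.2) i.1) i.2.1,
    fun i p => Fin.cases (Fin.cases 0 (fun j => Fin.cases 0 (fun k => -∑ l, w (j, k, l) p) i.2.1)
      i.1) (fun l => Fin.cases 0 (fun j => Fin.cases 0 (fun k => w (j, k, l) p) i.2.1) i.1) i.2.2,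
    fun g p => ?_, fun g p => ?_, fun g p => ?_, fun g p q => ?_, fun g p q => ?_, fun g p q => ?_,
    fun p q r => ?_⟩
  · rw [Fintype.sum_prod_type, Finset.sum_comm]
    refine Finset.sum_eq_zero fun jk _ => ?_
    obtain ⟨j, k⟩ := jk
    rw [Fin.sum_univ_succ]
    cases j using Fin.cases <;> cases k using Fin.cases <;> simp [Finset.sum_mul]
  · simp only [Fintype.sum_prod_type]
    refine Finset.sum_eq_zero fun j _ => ?_
    rw [Finset.sum_comm]
    refine Finset.sum_eq_zero fun k _ => ?_
    rw [Fin.sum_univ_succ]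
    cases j using Fin.cases <;> cases k using Fin.cases <;> simp [Finset.sum_mul]
  · simp only [Fintype.sum_prod_type]
    refine Finset.sum_eq_zero fun j _ => Finset.sum_eq_zero fun k _ => ?_
    rw [Fin.sum_univ_succ]
    cases j using Fin.cases <;> cases k using Fin.cases <;> simp [Finset.sum_mul]
  · refine Eq.trans ?_ (huv (fun k => g k.succ) p q)
    simp [Fintype.sum_prod_type, Fin.sum_univ_succ]
  · refine Eq.trans ?_ (huw (fun k => g k.succ) p q)
    simp [Fintype.sum_prod_type, Fin.sum_univ_succ]
  · refine Eq.trans ?_ (hvw (fun k => g k.succ) p q)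
    simp [Fintype.sum_prod_type, Fin.sum_univ_succ]
  · rw [← huvw p q r]
    simp [Fintype.sum_prod_type, Fin.sum_univ_succ]

/-! ### The degeneration -/

/-- Coordinatewise expansion in `ε` of the approximating sum. -/
theorem approx_eq {α β γ : Type} [Fintype α] [Fintype β] [Fintype γ]
    (a : α → ℂ) (b : β → ℂ) (c : γ → ℂ) (d u v w : α × β × γ → ℂ) (z ε : ℂ) (hε : ε ≠ 0)
    (hu : ∑ i, u i * (b i.2.1 * c i.2.2) = 0) (hv : ∑ i, v i * (a i.1 * c i.2.2) = 0)
    (hw : ∑ i, w i * (a i.1 * b i.2.1) = 0) (huv : ∑ i, u i * v i * c i.2.2 = 0)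
    (huw : ∑ i, u i * w i * b i.2.1 = 0) (hvw : ∑ i, v i * w i * a i.1 = 0) :
    ∑ i, (a i.1 + ε * u i) * (b i.2.1 + ε * v i) * (c i.2.2 + ε * w i) * (d i + z / ε ^ 3) +
      (∑ i, a i) * (∑ i, b i) * (∑ i, c i) * (-(z / ε ^ 3)) =
    ∑ i, a i.1 * b i.2.1 * c i.2.2 * d i + (∑ i, u i * v i * w i) * z +
      ε * ∑ i, d i * ((u i * (b i.2.1 * c i.2.2) + v i * (a i.1 * c i.2.2) +
        w i * (a i.1 * b i.2.1)) + ε * (u i * v i * c i.2.2 + u i * w i * b i.2.1 +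
        v i * w i * a i.1) + ε ^ 2 * (u i * v i * w i)) := by
  have habc : (∑ i, a i) * (∑ i, b i) * (∑ i, c i) =
      ∑ i : α × β × γ, a i.1 * b i.2.1 * c i.2.2 := by
    simp only [Fintype.sum_prod_type, ← Finset.mul_sum, ← Finset.sum_mul]
  have key : ∀ i, (a i.1 + ε * u i) * (b i.2.1 + ε * v i) * (c i.2.2 + ε * w i) *
        (d i + z / ε ^ 3) =
      a i.1 * b i.2.1 * c i.2.2 * d i + (u i * v i * w i) * z +
      ε * (d i * ((u i * (b i.2.1 * c i.2.2) + v i * (a i.1 * c i.2.2) +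
        w i * (a i.1 * b i.2.1)) + ε * (u i * v i * c i.2.2 + u i * w i * b i.2.1 +
        v i * w i * a i.1) + ε ^ 2 * (u i * v i * w i))) +
      a i.1 * b i.2.1 * c i.2.2 * (z / ε ^ 3) +
      (u i * (b i.2.1 * c i.2.2)) * (z / ε ^ 2) + (v i * (a i.1 * c i.2.2)) * (z / ε ^ 2) +
      (w i * (a i.1 * b i.2.1)) * (z / ε ^ 2) + (u i * v i * c i.2.2) * (z / ε) +
      (u i * w i * b i.2.1) * (z / ε) + (v i * w i * a i.1) * (z / ε) := by
    intro i
    field_simp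
    ring
  simp only [key, Finset.sum_add_distrib, ← Finset.sum_mul, ← Finset.mul_sum, hu, hv, hw, huv,
    huw, hvw, habc]
  ring

/-- The tensor `T₁ ⊕ T₂`, written in terms of vectors whose triple products sum to the unit
tensor. -/
theorem dsum_spider3_ghz4 {m₁ m₂ m₃ M : ℕ} (u v w : Fin m₁ × Fin m₂ × Fin m₃ → Fin M → ℂ)
    (huvw : ∀ p q r, ∑ i, u i p * v i q * w i r = delta p q * delta q r)
    (p₀ : Fin m₁ ⊕ Fin M) (p₁ : Fin m₂ ⊕ Fin M) (p₂ : Fin m₃ ⊕ Fin M)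
    (p₃ : (Fin m₁ × Fin m₂ × Fin m₃) ⊕ Fin 1) :
    dsum (spider3 m₁ m₂ m₃) (ghz4 M) (quad p₀ p₁ p₂ p₃) =
      ∑ i : Fin m₁ × Fin m₂ × Fin m₃, (Sum.elim (fun p => delta i.1 p) 0 p₀ : ℂ) *
        (Sum.elim (fun p => delta i.2.1 p) 0 p₁ : ℂ) *
        (Sum.elim (fun p => delta i.2.2 p) 0 p₂ : ℂ) * (Sum.elim (fun p => delta i p) 0 p₃ : ℂ) +
      (∑ i, (Sum.elim 0 (u i) p₀ : ℂ) * (Sum.elim 0 (v i) p₁ : ℂ) * (Sum.elim 0 (w i) p₂ : ℂ)) *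
        (Sum.elim 0 1 p₃ : ℂ) := by
  rcases p₀ with p₀ | p₀ <;> rcases p₁ with p₁ | p₁ <;> rcases p₂ with p₂ | p₂ <;>
    rcases p₃ with p₃ | p₃
  case inl.inl.inl.inl =>
    refine (dsum_inl _ _ _ (quad p₀ p₁ p₂ p₃) fun i => by fin_cases i <;> rfl).trans ?_
    change delta p₃ (p₀, p₁, p₂) = _
    simpa using (sum_delta_prod p₀ p₁ p₂ p₃).symm
  case inr.inr.inr.inr =>
    refine (dsum_inr _ _ _ (quad p₀ p₁ p₂ p₃) fun i => by fin_cases i <;> rfl).trans ?_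
    change delta p₀ p₁ * delta p₁ p₂ = _
    simpa using (huvw p₀ p₁ p₂).symm
  all_goals
    first
      | refine (dsum_mixed _ _ _ (i := 0) (j := 1) rfl rfl).trans ?_
      | refine (dsum_mixed _ _ _ (i := 1) (j := 0) rfl rfl).trans ?_
      | refine (dsum_mixed _ _ _ (i := 0) (j := 2) rfl rfl).trans ?_
      | refine (dsum_mixed _ _ _ (i := 2) (j := 0) rfl rfl).trans ?_
      | refine (dsum_mixed _ _ _ (i := 0) (j := 3) rfl rfl).trans ?_
      | refine (dsum_mixed _ _ _ (i := 3) (j := 0) rfl rfl).trans ?_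
    simp

theorem hasBorderRankLE_dsum {n₁ n₂ n₃ M : ℕ} (hind : IndepCond n₁ n₂ n₃ M) :
    HasBorderRankLE (dsum (spider3 (n₁ + 1) (n₂ + 1) (n₃ + 1)) (ghz4 M))
      ((n₁ + 1) * (n₂ + 1) * (n₃ + 1) + 1) := by
  obtain ⟨u, v, w, hu, hv, hw, huv, huw, hvw, huvw⟩ := hind.exists_extension
  let I := Fin (n₁ + 1) × Fin (n₂ + 1) × Fin (n₃ + 1)
  let A : Fin (n₁ + 1) → Fin (n₁ + 1) ⊕ Fin M → ℂ := fun i => Sum.elim (fun p => delta i p) 0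
  let B : Fin (n₂ + 1) → Fin (n₂ + 1) ⊕ Fin M → ℂ := fun i => Sum.elim (fun p => delta i p) 0
  let C : Fin (n₃ + 1) → Fin (n₃ + 1) ⊕ Fin M → ℂ := fun i => Sum.elim (fun p => delta i p) 0
  let D : I → I ⊕ Fin 1 → ℂ := fun i => Sum.elim (fun p => delta i p) 0
  let Z : I ⊕ Fin 1 → ℂ := Sum.elim 0 1
  let U : I → Fin (n₁ + 1) ⊕ Fin M → ℂ := fun i => Sum.elim 0 (u i)
  let V : I → Fin (n₂ + 1) ⊕ Fin M → ℂ := fun i => Sum.elim 0 (v i)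
  let W : I → Fin (n₃ + 1) ⊕ Fin M → ℂ := fun i => Sum.elim 0 (w i)
  have hU : ∀ (g : Fin (n₂ + 1) → Fin (n₃ + 1) → ℂ) p, ∑ i, U i p * g i.2.1 i.2.2 = 0 := by
    rintro g (p | p)
    · simp [U]
    · exact hu g p
  have hV : ∀ (g : Fin (n₁ + 1) → Fin (n₃ + 1) → ℂ) p, ∑ i, V i p * g i.1 i.2.2 = 0 := by
    rintro g (p | p)
    · simp [V]
    · exact hv g p
  have hW : ∀ (g : Fin (n₁ + 1) → Fin (n₂ + 1) → ℂ) p, ∑ i, W i p * g i.1 i.2.1 = 0 := by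
    rintro g (p | p)
    · simp [W]
    · exact hw g p
  have hUV : ∀ (g : Fin (n₃ + 1) → ℂ) p q, ∑ i, U i p * V i q * g i.2.2 = 0 := by
    rintro g (p | p) (q | q)
    iterate 3 simp [U, V]
    exact huv g p q
  have hUW : ∀ (g : Fin (n₂ + 1) → ℂ) p q, ∑ i, U i p * W i q * g i.2.1 = 0 := by
    rintro g (p | p) (q | q)
    iterate 3 simp [U, W]
    exact huw g p q
  have hVW : ∀ (g : Fin (n₁ + 1) → ℂ) p q, ∑ i, V i p * W i q * g i.1 = 0 := by
    rintro g (p | p) (q | q)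
    iterate 3 simp [V, W]
    exact hvw g p q
  let f : ℂ → Tensor (fun i => (![Fin (n₁ + 1), Fin (n₂ + 1), Fin (n₃ + 1), I] : Fin 4 → Type) i ⊕
      (![Fin M, Fin M, Fin M, Fin 1] : Fin 4 → Type) i) := fun ε x =>
    ∑ i : I, (A i.1 (x 0) + ε * U i (x 0)) * (B i.2.1 (x 1) + ε * V i (x 1)) *
        (C i.2.2 (x 2) + ε * W i (x 2)) * (D i (x 3) + Z (x 3) / ε ^ 3) +
      (∑ i, A i (x 0)) * (∑ i, B i (x 1)) * (∑ i, C i (x 2)) * (-(Z (x 3) / ε ^ 3))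
  have hrank : ∀ ε, HasRankLE (f ε) ((n₁ + 1) * (n₂ + 1) * (n₃ + 1) + 1) := by
    intro ε
    refine hasRankLE_of_sum (α := Option I) (by simp [I, mul_assoc]) (fun o => o.elim
      (quad (fun y => ∑ i, A i y) (fun y => ∑ i, B i y) (fun y => ∑ i, C i y)
        (fun y => -(Z y / ε ^ 3)))
      (fun i => quad (fun y => A i.1 y + ε * U i y) (fun y => B i.2.1 y + ε * V i y)
        (fun y => C i.2.2 y + ε * W i y) (fun y => D i y + Z y / ε ^ 3))) fun x => ?_
    simp only [Fintype.sum_option, Fin.prod_univ_four]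
    exact add_comm _ _
  have hlim : ∀ x, dsum (spider3 (n₁ + 1) (n₂ + 1) (n₃ + 1)) (ghz4 M) x =
      ∑ i : I, A i.1 (x 0) * B i.2.1 (x 1) * C i.2.2 (x 2) * D i (x 3) +
        (∑ i, U i (x 0) * V i (x 1) * W i (x 2)) * Z (x 3) := by
    intro x
    rw [eq_quad x]
    exact dsum_spider3_ghz4 u v w huvw (x 0) (x 1) (x 2) (x 3)
  refine mem_closure_of_tendsto (f := f) (b := nhdsWithin 0 {0}ᶜ) ?_
    (Filter.Eventually.of_forall hrank)
  rw [tendsto_pi_nhds]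
  intro x
  have hcont : Filter.Tendsto (fun ε : ℂ =>
      dsum (spider3 (n₁ + 1) (n₂ + 1) (n₃ + 1)) (ghz4 M) x + ε * ∑ i, D i (x 3) *
        ((U i (x 0) * (B i.2.1 (x 1) * C i.2.2 (x 2)) + V i (x 1) * (A i.1 (x 0) * C i.2.2 (x 2)) +
        W i (x 2) * (A i.1 (x 0) * B i.2.1 (x 1))) +
        ε * (U i (x 0) * V i (x 1) * C i.2.2 (x 2) + U i (x 0) * W i (x 2) * B i.2.1 (x 1) +
        V i (x 1) * W i (x 2) * A i.1 (x 0)) + ε ^ 2 * (U i (x 0) * V i (x 1) * W i (x 2))))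
      (nhdsWithin 0 {0}ᶜ)
      (nhds (dsum (spider3 (n₁ + 1) (n₂ + 1) (n₃ + 1)) (ghz4 M) x)) := by
    refine (Continuous.tendsto' ?_ 0 _ (by simp)).mono_left nhdsWithin_le_nhds
    fun_prop
  refine hcont.congr' ?_
  filter_upwards [self_mem_nhdsWithin] with ε hε
  rw [hlim x]
  exact (approx_eq (fun i => A i (x 0)) (fun i => B i (x 1)) (fun i => C i (x 2))
    (fun i => D i (x 3)) (fun i => U i (x 0)) (fun i => V i (x 1)) (fun i => W i (x 2)) (Z (x 3))
    ε hε (hU (fun j k => B j (x 1) * C k (x 2)) _) (hV (fun j k => A j (x 0) * C k (x 2)) _)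
    (hW (fun j k => A j (x 0) * B k (x 1)) _) (hUV (fun k => C k (x 2)) _ _)
    (hUW (fun k => B k (x 1)) _ _) (hVW (fun k => A k (x 0)) _ _)).symm

/-- Theorem: Construction 4, adding a higher order tensor. If the
independence condition holds for `(n₁, n₂, n₃, M)`, then
`R̲(T₁) = (n₁+1)(n₂+1)(n₃+1)`, `R̲(T₂) = M`, and
`R̲(T₁ ⊕ T₂) = (n₁+1)(n₂+1)(n₃+1) + 1`. -/
theorem construction4 (n₁ n₂ n₃ M : ℕ) (h₁ : 1 ≤ n₁) (h₂ : 1 ≤ n₂) (h₃ : 1 ≤ n₃)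
    (hM : 1 ≤ M) (hind : IndepCond n₁ n₂ n₃ M) :
    borderRank (spider3 (n₁ + 1) (n₂ + 1) (n₃ + 1)) = (n₁ + 1) * (n₂ + 1) * (n₃ + 1) ∧
    borderRank (ghz4 M) = M ∧
    borderRank (dsum (spider3 (n₁ + 1) (n₂ + 1) (n₃ + 1)) (ghz4 M)) =
      (n₁ + 1) * (n₂ + 1) * (n₃ + 1) + 1 := by
  obtain ⟨m, rfl⟩ : ∃ m, M = m + 1 := ⟨M - 1, by omega⟩
  let I := Fin (n₁ + 1) × Fin (n₂ + 1) × Fin (n₃ + 1)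
  have hI : Fintype.card I = (n₁ + 1) * (n₂ + 1) * (n₃ + 1) := by simp [I, mul_assoc]
  refine ⟨borderRank_eq (HasRankLE.hasBorderRankLE ?_) fun r hr => ?_,
    borderRank_eq (HasRankLE.hasBorderRankLE ?_) fun r hr => ?_,
    borderRank_eq (hasBorderRankLE_dsum hind) fun r hr => ?_⟩
  · refine hasRankLE_of_sum (α := I) hI (fun i => quad (fun p => delta (α := Fin (n₁ + 1)) i.1 p)
      (fun p => delta (α := Fin (n₂ + 1)) i.2.1 p) (fun p => delta (α := Fin (n₃ + 1)) i.2.2 p)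
      (fun p => delta (α := I) i p)) fun x => ?_
    simp only [Fin.prod_univ_four]
    exact (sum_delta_prod (α := Fin (n₁ + 1)) (β := Fin (n₂ + 1)) (γ := Fin (n₃ + 1))
      (x 0) (x 1) (x 2) (x 3)).symm
  · rw [← hI]
    refine hr.card_le 3 (fun i : I => quad i.1 i.2.1 i.2.2 i) fun s t => ?_
    rfl
  · refine hasRankLE_of_sum (α := Fin (m + 1)) (Fintype.card_fin _) (fun i => quad
      (fun p => delta (α := Fin (m + 1)) i p) (fun p => delta (α := Fin (m + 1)) i p)
      (fun p => delta (α := Fin (m + 1)) i p) (fun _ => 1)) fun x => ?_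
    simp only [Fin.prod_univ_four]
    exact (sum_delta_cube (α := Fin (m + 1)) (x 0) (x 1) (x 2)).symm
  · rw [← Fintype.card_fin (m + 1)]
    refine hr.card_le 0 (fun i : Fin (m + 1) => quad i i i (0 : Fin 1)) fun s t => ?_
    change delta s t * delta t t = _
    simp [delta]
  · have hcard : Fintype.card (Option I) = (n₁ + 1) * (n₂ + 1) * (n₃ + 1) + 1 := by simp [← hI]
    rw [← hcard]
    refine hr.card_le 3 (fun o : Option I => o.elim
      (quad (.inr (0 : Fin (m + 1))) (.inr (0 : Fin (m + 1))) (.inr (0 : Fin (m + 1)))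
        (.inr (0 : Fin 1)))
      (fun i => quad (.inl i.1) (.inl i.2.1) (.inl i.2.2) (.inl i))) fun s t => ?_
    rcases s with _ | s <;> rcases t with _ | t
    · refine (dsum_inr _ _ _ (quad (0 : Fin (m + 1)) (0 : Fin (m + 1)) (0 : Fin (m + 1))
        (0 : Fin 1)) fun i => by fin_cases i <;> rfl).trans ?_
      change delta (0 : Fin (m + 1)) 0 * delta (0 : Fin (m + 1)) 0 = _
      simp [delta]
    · exact dsum_mixed _ _ _ (i := 0) (j := 3) rfl rfl
    · exact dsum_mixed _ _ _ (i := 3) (j := 0) rfl rfl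
    · refine (dsum_inl _ _ _ (quad t.1 t.2.1 t.2.2 s) fun i => by fin_cases i <;> rfl).trans ?_
      change delta s t = _
      simp [delta]

end
end Subadditivity
end

section
/- Let n ≥ 1 and d ≥ 3 be integers and let p ∈ (0,1) be a rational number. Let T₁ = Σ_{i₁,…,i_d=1}^{n} e_{i₁} ⊗ ⋯ ⊗ e_{i_d} ⊗ e_{(i₁,…,i_d)} ∈ (ℂ^n)^{⊗d} ⊗ ℂ^{n^d} and let T₂ = Σ_{j=1}^{n^d} e_j ⊗ e_j ⊗ e₀ ⊗ ⋯ ⊗ e₀ ∈ ℂ^{n^d} ⊗ ℂ^{n^d} ⊗ ℂ¹ ⊗ ⋯ ⊗ ℂ¹ (both tensors of order d+1). Then the limit superior, over integers N → ∞ such that pN is an integer, of R̲(T₁^{⊠pN} ⊠ T₂^{⊠(1−p)N})^{1/N} is at most (n^d + 2n^{d−1} + n²(n+1)^{d−3} + 1) · 2^{−h(p)}. (This expresses the exponent bound ω(multiEMaMu(d; n, n^{d(1−p)/p})) ≤ (1/p)[log₂(n^d + 2n^{d−1} + n²(n+1)^{d−3} + 1) − h(p)].) -/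
open Finset

namespace Subadditivity

noncomputable section

/-- Factor index types of the order-`(d+1)` spider tensor: positions `0, …, d-1`
carry `ℂ^n`, and position `d` carries `ℂ^{n^d}`, indexed by `d`-tuples. -/
def famV (n d : ℕ) : Fin (d + 1) → Type :=
  fun i => if (i : ℕ) < d then Fin n else (Fin d → Fin n)

def vlow {n d : ℕ} {i : Fin (d + 1)} (h : (i : ℕ) < d) (u : famV n d i) : Fin n :=
  cast (by simp [famV, h]) u

def vhigh {n d : ℕ} {i : Fin (d + 1)} (h : ¬ (i : ℕ) < d) (u : famV n d i) :
    Fin d → Fin n :=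
  cast (by simp [famV, h]) u

/-- The order-`(d+1)` spider tensor
`T₁ = Σ_{i₁,…,i_d} e_{i₁} ⊗ ⋯ ⊗ e_{i_d} ⊗ e_{(i₁,…,i_d)} ∈ (ℂ^n)^{⊗d} ⊗ ℂ^{n^d}`. -/
def bigSpider (n d : ℕ) : Tensor (famV n d) := fun x =>
  ∏ j : Fin d, delta (α := Fin n)
    (vlow (i := Fin.castSucc j) (by simp) (x (Fin.castSucc j)))
    (vhigh (i := Fin.last d) (by simp) (x (Fin.last d)) j)

/-- Factor index types of the order-`(d+1)` tensor `T₂`: positions `0, 1` carry `ℂ^N`,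
all other positions carry `ℂ¹`. -/
def famW (N d : ℕ) : Fin (d + 1) → Type :=
  fun i => if (i : ℕ) < 2 then Fin N else Fin 1

def wlow {N d : ℕ} {i : Fin (d + 1)} (h : (i : ℕ) < 2) (u : famW N d i) : Fin N :=
  cast (by simp [famW, h]) u

/-- The order-`(d+1)` tensor `T₂ = Σ_{j=1}^N e_j ⊗ e_j ⊗ e₀ ⊗ ⋯ ⊗ e₀ ∈ ℂ^N ⊗ ℂ^N ⊗ ℂ¹ ⊗ ⋯ ⊗ ℂ¹`. -/
def bigMat (N d : ℕ) (hd : 1 ≤ d) : Tensor (famW N d) := fun x =>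
  delta (α := Fin N)
    (wlow (i := (⟨0, Nat.succ_pos d⟩ : Fin (d + 1))) (by simp) (x ⟨0, Nat.succ_pos d⟩))
    (wlow (i := (⟨1, by omega⟩ : Fin (d + 1))) (by simp) (x ⟨1, by omega⟩))

/-- The binary entropy function `h(p) = −p·log₂ p − (1−p)·log₂(1−p)`. -/
def binEnt (p : ℚ) : ℝ :=
  -(p : ℝ) * Real.logb 2 (p : ℝ) - (1 - (p : ℝ)) * Real.logb 2 (1 - (p : ℝ))

/-- The filter of integers `N → ∞` such that `p·N` is an integer. -/
def pIntFilter (p : ℚ) : Filter ℕ :=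
  Filter.atTop ⊓ Filter.principal {N : ℕ | ∃ m : ℕ, (m : ℚ) = p * N}

section OrderThree

variable {α β γ α' β' γ' : Type}

/-- `M` is a sum of `r` simple tensors of order three. -/
def TriRankLE {α β γ : Type} (M : α → β → γ → ℂ) (r : ℕ) : Prop :=
  ∃ (u : Fin r → α → ℂ) (v : Fin r → β → ℂ) (w : Fin r → γ → ℂ),
    M = fun a b c => ∑ j, u j a * v j b * w j c

/-- `M` is a limit of sums of `r` simple tensors of order three. -/
def TriBorderLE {α β γ : Type} (M : α → β → γ → ℂ) (r : ℕ) : Prop :=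
  M ∈ closure {S : α → β → γ → ℂ | TriRankLE S r}

theorem TriRankLE.of_card_le {J : Type} [Fintype J] {r : ℕ} (h : Fintype.card J ≤ r)
    (u : J → α → ℂ) (v : J → β → ℂ) (w : J → γ → ℂ) :
    TriRankLE (fun a b c => ∑ j, u j a * v j b * w j c) r := by
  classical
  obtain ⟨f⟩ : Nonempty (J ↪ Fin r) :=
    Function.Embedding.nonempty_of_card_le (by simpa using h)
  refine ⟨fun i a => ∑ j, if f j = i then u j a else 0,
    fun i a => ∑ j, if f j = i then v j a else 0,
    fun i a => ∑ j, if f j = i then w j a else 0, ?_⟩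
  funext a b c
  have hin : ∀ (g : J → ℂ) (j : J), (∑ k, if f k = f j then g k else 0) = g j := by
    intro g j
    rw [Finset.sum_eq_single j] <;> simp +contextual
  rw [← Finset.sum_subset (Finset.subset_univ (univ.map f))]
  · rw [Finset.sum_map]
    exact Finset.sum_congr rfl fun j _ => by simp only [hin]
  · intro i _ hi
    have : ∀ j, f j ≠ i := by simpa using hi
    simp [this]

theorem TriRankLE.exists_index {M : α → β → γ → ℂ} {r : ℕ} (hM : TriRankLE M r)
    {I : Type} [Fintype I] (h : r ≤ Fintype.card I) :
    ∃ (u : I → α → ℂ) (v : I → β → ℂ) (w : I → γ → ℂ),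
      M = fun a b c => ∑ j, u j a * v j b * w j c := by
  obtain ⟨u, v, w, rfl⟩ := hM
  obtain ⟨u', v', w', h'⟩ := TriRankLE.of_card_le (J := Fin r) (by simpa using h) u v w
  let e := Fintype.equivFin I
  refine ⟨fun i => u' (e i), fun i => v' (e i), fun i => w' (e i), ?_⟩
  rw [h']
  funext a b c
  exact (Equiv.sum_comp e (fun j => u' j a * v' j b * w' j c)).symm

theorem TriRankLE.triBorderLE {M : α → β → γ → ℂ} {r : ℕ} (hM : TriRankLE M r) :
    TriBorderLE M r := subset_closure hM

theorem TriBorderLE.mono {M : α → β → γ → ℂ} {r s : ℕ} (hM : TriBorderLE M r) (h : r ≤ s) :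
    TriBorderLE M s := by
  refine closure_mono ?_ hM
  rintro _ ⟨u, v, w, rfl⟩
  exact TriRankLE.of_card_le (by simpa using h) u v w

theorem TriBorderLE.pullback {M : α → β → γ → ℂ} {r : ℕ} (hM : TriBorderLE M r)
    (f : α' → α) (g : β' → β) (h : γ' → γ) :
    TriBorderLE (fun a b c => M (f a) (g b) (h c)) r := by
  refine map_mem_closure (f := fun (S : α → β → γ → ℂ) a b c => S (f a) (g b) (h c))
    (by fun_prop) hM ?_
  rintro _ ⟨u, v, w, rfl⟩
  exact ⟨fun j a => u j (f a), fun j b => v j (g b), fun j c => w j (h c), rfl⟩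

theorem TriBorderLE.add {M M' : α → β → γ → ℂ} {r s : ℕ} (hM : TriBorderLE M r)
    (hM' : TriBorderLE M' s) : TriBorderLE (fun a b c => M a b c + M' a b c) (r + s) := by
  refine map_mem_closure₂ (f := fun (S S' : α → β → γ → ℂ) a b c => S a b c + S' a b c)
    (by fun_prop) hM hM' ?_
  rintro _ ⟨u, v, w, rfl⟩ _ ⟨u', v', w', rfl⟩
  convert TriRankLE.of_card_le (J := Fin r ⊕ Fin s) (r := r + s) (by simp)
    (Sum.elim u u') (Sum.elim v v') (Sum.elim w w') using 4
  simp

theorem TriBorderLE.sum {I : Type} (s : Finset I) {M : I → α → β → γ → ℂ} {r : ℕ}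
    (hM : ∀ i, TriBorderLE (M i) r) :
    TriBorderLE (fun a b c => ∑ i ∈ s, M i a b c) (s.card * r) := by
  classical
  induction s using Finset.induction_on with
  | empty =>
    simp only [sum_empty]
    exact TriRankLE.triBorderLE ((TriRankLE.of_card_le (J := Empty) (by simp) nofun nofun nofun))
  | insert i s hi ih =>
    simp only [sum_insert hi, card_insert_of_notMem hi]
    exact ((hM i).add ih).mono (by rw [add_mul, one_mul, add_comm])

/-- Kronecker product of tensors of order three. -/
def triKron (M : α → β → γ → ℂ) (M' : α' → β' → γ' → ℂ) :
    α × α' → β × β' → γ × γ' → ℂ :=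
  fun a b c => M a.1 b.1 c.1 * M' a.2 b.2 c.2

theorem TriBorderLE.kronecker {M : α → β → γ → ℂ} {M' : α' → β' → γ' → ℂ} {r s : ℕ}
    (hM : TriBorderLE M r) (hM' : TriBorderLE M' s) :
    TriBorderLE (triKron M M') (r * s) := by
  refine map_mem_closure₂ (f := triKron)
    (by unfold triKron; fun_prop) hM hM' ?_
  rintro _ ⟨u, v, w, rfl⟩ _ ⟨u', v', w', rfl⟩
  change TriRankLE _ _
  convert TriRankLE.of_card_le (J := Fin r × Fin s) (r := r * s) (by simp)
    (fun j (a : α × α') => u j.1 a.1 * u' j.2 a.2) (fun j (a : β × β') => v j.1 a.1 * v' j.2 a.2)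
    (fun j (a : γ × γ') => w j.1 a.1 * w' j.2 a.2) using 1
  funext a b c
  simp only [triKron, Finset.sum_mul_sum, Fintype.sum_prod_type]
  exact Finset.sum_congr rfl fun _ _ => Finset.sum_congr rfl fun _ _ => by ring

theorem TriBorderLE.pow {M : α → β → γ → ℂ} {r : ℕ} (hM : TriBorderLE M r) (N : ℕ) :
    TriBorderLE (fun (a : Fin N → α) (b : Fin N → β) (c : Fin N → γ) =>
      ∏ j, M (a j) (b j) (c j)) (r ^ N) := by
  induction N with
  | zero =>
    simpa using (TriRankLE.of_card_le (J := Unit) (r := 1) (by simp) (fun _ (_ : Fin 0 → α) => 1)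
      (fun _ (_ : Fin 0 → β) => 1) (fun _ (_ : Fin 0 → γ) => 1)).triBorderLE
  | succ N ih =>
    convert (hM.kronecker ih).pullback (fun a : Fin (N + 1) → α => (a 0, Fin.tail a))
      (fun b : Fin (N + 1) → β => (b 0, Fin.tail b))
      (fun c : Fin (N + 1) → γ => (c 0, Fin.tail c)) using 1
    · funext a b c
      simp [Fin.prod_univ_succ, triKron, Fin.tail]
    · rw [pow_succ, mul_comm]

/-- The direct sum of copies of `M` indexed by `J`. -/
def copies (J : Type) [DecidableEq J] (M : α → β → γ → ℂ) :
    J × α → J × β → J × γ → ℂ :=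
  fun a b c => if a.1 = b.1 ∧ b.1 = c.1 then M a.2 b.2 c.2 else 0

theorem TriBorderLE.contract {J : Type} [Fintype J] {U : J × α → J × β → J × γ → ℂ} {r : ℕ}
    (hU : TriBorderLE U r) (x : J → α' → ℂ) (y : J → β' → ℂ) (z : J → γ' → ℂ) :
    TriBorderLE (fun (a : α' × α) (b : β' × β) (c : γ' × γ) =>
      ∑ i, ∑ j, ∑ k, x i a.1 * y j b.1 * z k c.1 * U (i, a.2) (j, b.2) (k, c.2)) r := by
  refine map_mem_closure (f := fun (U : J × α → J × β → J × γ → ℂ)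
    (a : α' × α) (b : β' × β) (c : γ' × γ) =>
      ∑ i, ∑ j, ∑ k, x i a.1 * y j b.1 * z k c.1 * U (i, a.2) (j, b.2) (k, c.2))
    (by fun_prop) hU ?_
  rintro _ ⟨u, v, w, rfl⟩
  refine ⟨fun l a => ∑ i, x i a.1 * u l (i, a.2), fun l a => ∑ i, y i a.1 * v l (i, a.2),
    fun l a => ∑ i, z i a.1 * w l (i, a.2), ?_⟩
  funext a b c
  have hprod : ∀ A B C : J → ℂ,
      (∑ i, A i) * (∑ j, B j) * (∑ k, C k) = ∑ i, ∑ j, ∑ k, A i * B j * C k := by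
    intro A B C
    rw [Finset.sum_mul_sum, Finset.sum_mul]
    refine Finset.sum_congr rfl fun i _ => ?_
    rw [Finset.sum_mul]
    exact Finset.sum_congr rfl fun j _ => Finset.mul_sum ..
  simp only [hprod]
  rw [Finset.sum_comm (s := (univ : Finset (Fin r)))]
  refine Finset.sum_congr rfl fun i _ => ?_
  rw [Finset.sum_comm (s := (univ : Finset (Fin r)))]
  refine Finset.sum_congr rfl fun j _ => ?_
  rw [Finset.sum_comm (s := (univ : Finset (Fin r)))]
  refine Finset.sum_congr rfl fun k _ => ?_
  rw [Finset.mul_sum]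
  exact Finset.sum_congr rfl fun l _ => by ring

theorem TriBorderLE.copies_kronecker {J : Type} [Fintype J] [DecidableEq J]
    {P : α → β → γ → ℂ} {P' : α' → β' → γ' → ℂ} {r r' q : ℕ}
    (hP : TriBorderLE (copies J P) r) (hP' : TriBorderLE (copies J P') r')
    (hq : r ≤ q * Fintype.card J) :
    TriBorderLE (copies J (triKron P P')) (q * r') := by
  have key : TriBorderLE (triKron (copies J P) P') (q * r') := by
    have hclosed : IsClosed {U : J × α → J × β → J × γ → ℂ |
        TriBorderLE (triKron U P') (q * r')} :=
      isClosed_closure.preimage (f := fun U : J × α → J × β → J × γ → ℂ => triKron U P')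
        (by unfold triKron; fun_prop)
    refine closure_minimal ?_ hclosed hP
    intro U hU
    obtain ⟨u, v, w, rfl⟩ := hU.exists_index (I := Fin q × J) (by simpa using hq)
    have := TriBorderLE.sum (univ : Finset (Fin q)) fun i =>
      hP'.contract (fun j => u (i, j)) (fun j => v (i, j)) (fun j => w (i, j))
    rw [Finset.card_univ, Fintype.card_fin] at this
    change TriBorderLE _ _
    convert this using 1
    funext a b c
    simp only [triKron, Fintype.sum_prod_type, Finset.sum_mul]
    refine Finset.sum_congr rfl fun i _ => Finset.sum_congr rfl fun j _ => ?_
    simp [copies, ite_and]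
  convert key.pullback (fun a : J × (α × α') => ((a.1, a.2.1), a.2.2))
    (fun a : J × (β × β') => ((a.1, a.2.1), a.2.2))
    (fun a : J × (γ × γ') => ((a.1, a.2.1), a.2.2)) using 1
  funext a b c
  simp [copies, triKron]

theorem TriBorderLE.of_copies {J : Type} [Nonempty J] [DecidableEq J]
    {P : α → β → γ → ℂ} {r : ℕ} (hP : TriBorderLE (copies J P) r) : TriBorderLE P r := by
  obtain ⟨j⟩ := ‹Nonempty J›
  simpa [copies] using hP.pullback (Prod.mk j) (Prod.mk j) (Prod.mk j)

theorem triBorderLE_copies_one {J : Type} [Fintype J] [DecidableEq J] :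
    TriBorderLE (copies J fun (_ : α) (_ : β) (_ : γ) => 1) (Fintype.card J) := by
  convert (TriRankLE.of_card_le (J := J) le_rfl (fun j (a : J × α) => if a.1 = j then 1 else 0)
    (fun j (b : J × β) => if b.1 = j then 1 else 0)
    (fun j (c : J × γ) => if c.1 = j then 1 else 0)).triBorderLE using 1
  funext a b c
  simp only [copies, mul_ite, mul_one, mul_zero]
  rw [Finset.sum_eq_single a.1]
  · simp [ite_and, eq_comm]
    aesop
  · intro j _ hj
    simp [hj.symm]
  · simp

/-- The Kronecker product of the `m`-th power of `t₁` and the `l`-th power of `t₂`. -/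
def mixedPow (t₁ : α → β → γ → ℂ) (t₂ : α' → β' → γ' → ℂ) (m l : ℕ) :
    (Fin m → α) × (Fin l → α') → (Fin m → β) × (Fin l → β') → (Fin m → γ) × (Fin l → γ') → ℂ :=
  fun a b c => (∏ j, t₁ (a.1 j) (b.1 j) (c.1 j)) * ∏ j, t₂ (a.2 j) (b.2 j) (c.2 j)

/-- The two parts of a pair of concatenated words, split at given positions. -/
def splitWords {ι κ : Type} (m m' l l' : ℕ) (a : (Fin (m + m') → ι) × (Fin (l + l') → κ)) :
    ((Fin m → ι) × (Fin l → κ)) × ((Fin m' → ι) × (Fin l' → κ)) :=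
  ((fun j => a.1 (Fin.castAdd m' j), fun j => a.2 (Fin.castAdd l' j)),
    (fun j => a.1 (Fin.natAdd m j), fun j => a.2 (Fin.natAdd l j)))

theorem mixedPow_add (t₁ : α → β → γ → ℂ) (t₂ : α' → β' → γ' → ℂ) (m m' l l' : ℕ) :
    mixedPow t₁ t₂ (m + m') (l + l') = fun a b c =>
      triKron (mixedPow t₁ t₂ m l) (mixedPow t₁ t₂ m' l')
        (splitWords m m' l l' a) (splitWords m m' l l' b) (splitWords m m' l l' c) := by
  funext a b c
  simp only [mixedPow, triKron, splitWords, Fin.prod_univ_add]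
  ring

theorem TriBorderLE.copies_pullback {J : Type} [DecidableEq J] {α₁ β₁ γ₁ : Type}
    {P : α → β → γ → ℂ} {r : ℕ}
    (hP : TriBorderLE (copies J P) r) (f : α₁ → α) (g : β₁ → β) (h : γ₁ → γ) :
    TriBorderLE (copies J fun a b c => P (f a) (g b) (h c)) r :=
  hP.pullback (Prod.map id f) (Prod.map id g) (Prod.map id h)

theorem TriBorderLE.copies_mixedPow_mul {J : Type} [Fintype J] [DecidableEq J]
    {t₁ : α → β → γ → ℂ} {t₂ : α' → β' → γ' → ℂ} {m l r q : ℕ}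
    (h : TriBorderLE (copies J (mixedPow t₁ t₂ m l)) r) (hq : r ≤ q * Fintype.card J) (k : ℕ) :
    TriBorderLE (copies J (mixedPow t₁ t₂ (m * k) (l * k))) (q ^ k * Fintype.card J) := by
  induction k with
  | zero =>
    have h0 : mixedPow t₁ t₂ 0 0 = fun _ _ _ => 1 := by
      funext a b c
      simp [mixedPow]
    simpa [h0] using triBorderLE_copies_one (J := J)
  | succ k ih =>
    rw [mul_add_one, mul_add_one, add_comm _ m, add_comm _ l, mixedPow_add, pow_succ',
      mul_assoc]
    exact (h.copies_kronecker ih hq).copies_pullback _ _ _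

/-- The direct sum of the copies of `t₁` indexed by `J` with `t₂`. -/
def triSum (J : Type) [DecidableEq J] (t₁ : α → β → γ → ℂ) (t₂ : α' → β' → γ' → ℂ) :
    (J × α) ⊕ α' → (J × β) ⊕ β' → (J × γ) ⊕ γ' → ℂ
  | .inl a, .inl b, .inl c => copies J t₁ a b c
  | .inr a, .inr b, .inr c => t₂ a b c
  | _, _, _ => 0

theorem exists_equiv_of_card_eq {m l : ℕ} (S : Finset (Fin (m + l))) (hS : S.card = m) :
    ∃ e : Fin m ⊕ Fin l ≃ Fin (m + l), ∀ x, e x ∈ S ↔ x.isLeft := by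
  have e₁ : Fin m ≃ {x // x ∈ S} := Fintype.equivOfCardEq (by simp [hS])
  have e₂ : Fin l ≃ {x // x ∉ S} := Fintype.equivOfCardEq (by
    rw [Fintype.card_subtype_compl]
    simp [hS])
  refine ⟨(Equiv.sumCongr e₁ e₂).trans (Equiv.sumCompl _), ?_⟩
  rintro (x | x)
  · simp
  · simpa using (e₂ x).2

theorem TriBorderLE.copies_mixedPow {J : Type} [Fintype J] [DecidableEq J]
    {t₁ : α → β → γ → ℂ} {t₂ : α' → β' → γ' → ℂ} {r : ℕ}
    (h : TriBorderLE (triSum J t₁ t₂) r) (m l : ℕ) :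
    TriBorderLE (copies ({S : Finset (Fin (m + l)) // S.card = m} × (Fin m → J))
      (mixedPow t₁ t₂ m l)) (r ^ (m + l)) := by
  choose e he using fun S : {S : Finset (Fin (m + l)) // S.card = m} =>
    exists_equiv_of_card_eq S.1 S.2
  let φ : ∀ {ι κ : Type}, ({S : Finset (Fin (m + l)) // S.card = m} × (Fin m → J)) ×
      ((Fin m → ι) × (Fin l → κ)) → Fin (m + l) → (J × ι) ⊕ κ := fun x i =>
    Sum.map (fun k => (x.1.2 k, x.2.1 k)) x.2.2 ((e x.1.1).symm i)
  have hφ : ∀ {ι κ : Type} (x : ({S : Finset (Fin (m + l)) // S.card = m} × (Fin m → J)) ×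
      ((Fin m → ι) × (Fin l → κ))) (i : Fin (m + l)), (φ x i).isLeft ↔ i ∈ x.1.1.1 := by
    intro ι κ x i
    rw [← (e x.1.1).apply_symm_apply i, he]
    simp [φ]
  have hzero : ∀ x y z, (¬ (x.isLeft = y.isLeft ∧ y.isLeft = z.isLeft)) →
      triSum J t₁ t₂ x y z = 0 := by
    rintro (x | x) (y | y) (z | z) <;> simp [triSum]
  convert (h.pow (m + l)).pullback φ φ φ using 1
  funext a b c
  by_cases hS : a.1.1 = b.1.1 ∧ b.1.1 = c.1.1
  · obtain ⟨⟨S, s⟩, a, a'⟩ := a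
    obtain ⟨⟨S', s'⟩, b, b'⟩ := b
    obtain ⟨⟨S'', s''⟩, c, c'⟩ := c
    obtain ⟨rfl, rfl⟩ : S = S' ∧ S' = S'' := hS
    rw [← Equiv.prod_comp (e S), Fintype.prod_sum_type]
    simp only [φ, Equiv.symm_apply_apply, Sum.map_inl, Sum.map_inr, triSum, copies, mixedPow,
      Prod.mk.injEq, true_and]
    by_cases hs : s = s' ∧ s' = s''
    · obtain ⟨rfl, rfl⟩ := hs
      simp
    · rw [if_neg hs]
      have : ∃ k, ¬ (s k = s' k ∧ s' k = s'' k) := by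
        by_contra! hcon
        exact hs ⟨funext fun k => (hcon k).1, funext fun k => (hcon k).2⟩
      obtain ⟨k, hk⟩ := this
      rw [Finset.prod_eq_zero (Finset.mem_univ k) (if_neg hk), zero_mul]
  · rw [eq_comm]
    have : ∃ i, ¬ ((φ a i).isLeft = (φ b i).isLeft ∧ (φ b i).isLeft = (φ c i).isLeft) := by
      by_contra! hcon
      refine hS ⟨Subtype.ext (Finset.ext fun i => ?_), Subtype.ext (Finset.ext fun i => ?_)⟩
      · rw [← hφ, ← hφ, (hcon i).1]
      · rw [← hφ, ← hφ, (hcon i).2]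
    obtain ⟨i, hi⟩ := this
    rw [Finset.prod_eq_zero (Finset.mem_univ i) (hzero _ _ _ hi), copies, if_neg]
    rintro ⟨h1, h2⟩
    exact hS ⟨by rw [h1], by rw [h2]⟩

end OrderThree

/-- The matrix multiplication tensor `⟨n, 1, n⟩`. -/
def outerTensor (n : ℕ) (a b : Fin n) (c : Fin n × Fin n) : ℂ :=
  if a = c.1 ∧ b = c.2 then 1 else 0

/-- The identity matrix as a tensor of order three. -/
def innerTensor (K : Type) [DecidableEq K] (a b : K) (_ : Unit) : ℂ :=
  if a = b then 1 else 0

/-- First factors of Schönhage's approximate decomposition. -/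
def schonhageU {J : Type} [DecidableEq J] {n : ℕ} (ε : ℂ) (j : J) :
    Option (Fin n) → Option (Fin n) → (J × Fin n) ⊕ (J × Fin n × Fin n) → ℂ
  | some k, some l =>
      Sum.elim (fun a => if j = a.1 ∧ k = a.2 then 1 else 0)
        (fun a => if j = a.1 ∧ k = a.2.1 ∧ l = a.2.2 then ε else 0)
  | some k, none => Sum.elim (fun a => if j = a.1 ∧ k = a.2 then 1 else 0) (fun _ => 0)
  | none, some l => Sum.elim (fun _ => 0) (fun a => if j = a.1 ∧ l = a.2.2 then -ε else 0)
  | none, none => Sum.elim (fun a => if j = a.1 then 1 else 0) (fun _ => 0)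

/-- Second factors of Schönhage's approximate decomposition. -/
def schonhageV {J : Type} [DecidableEq J] {n : ℕ} (ε : ℂ) (j : J) :
    Option (Fin n) → Option (Fin n) → (J × Fin n) ⊕ (J × Fin n × Fin n) → ℂ
  | some k, some l =>
      Sum.elim (fun b => if j = b.1 ∧ l = b.2 then 1 else 0)
        (fun b => if j = b.1 ∧ k = b.2.1 ∧ l = b.2.2 then ε else 0)
  | some k, none => Sum.elim (fun _ => 0) (fun b => if j = b.1 ∧ k = b.2.1 then -ε else 0)
  | none, some l => Sum.elim (fun b => if j = b.1 ∧ l = b.2 then 1 else 0) (fun _ => 0)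
  | none, none => Sum.elim (fun b => if j = b.1 then -1 else 0) (fun _ => 0)

/-- Third factors of Schönhage's approximate decomposition. -/
def schonhageW {J : Type} [DecidableEq J] {n : ℕ} (ε : ℂ) (j : J) :
    Option (Fin n) → Option (Fin n) → (J × Fin n × Fin n) ⊕ Unit → ℂ
  | some k, some l =>
      Sum.elim (fun c => if j = c.1 ∧ k = c.2.1 ∧ l = c.2.2 then 1 else 0) (fun _ => (ε ^ 2)⁻¹)
  | some _, none => Sum.elim (fun _ => 0) (fun _ => (ε ^ 2)⁻¹)
  | none, _ => Sum.elim (fun _ => 0) (fun _ => (ε ^ 2)⁻¹)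

theorem exists_schonhage_error {J : Type} [Fintype J] [DecidableEq J] (n : ℕ)
    (a b : (J × Fin n) ⊕ (J × Fin n × Fin n)) (c : (J × Fin n × Fin n) ⊕ Unit) :
    ∃ x y : ℂ, ∀ ε : ℂ, ε ≠ 0 →
      ∑ j : J × Option (Fin n) × Option (Fin n), schonhageU ε j.1 j.2.1 j.2.2 a *
        schonhageV ε j.1 j.2.1 j.2.2 b * schonhageW ε j.1 j.2.1 j.2.2 c =
      triSum J (outerTensor n) (innerTensor (J × Fin n × Fin n)) a b c + ε * x + ε ^ 2 * y := by
  simp only [Fintype.sum_prod_type, Fintype.sum_option, schonhageU, schonhageV, schonhageW]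
  rcases a with ⟨a₁, a₂⟩ | ⟨a₁, a₂, a₃⟩ <;> rcases b with ⟨b₁, b₂⟩ | ⟨b₁, b₂, b₃⟩ <;>
    rcases c with ⟨c₁, c₂, c₃⟩ | c
  · refine ⟨0, 0, fun ε hε => ?_⟩
    simp [ite_and, triSum, copies, outerTensor]
    grind
  · refine ⟨0, 0, fun ε hε => ?_⟩
    simp [ite_and, triSum, Finset.sum_add_distrib]
  · refine ⟨if a₁ = b₁ ∧ b₁ = c₁ ∧ a₂ = b₂ ∧ b₂ = c₂ ∧ b₃ = c₃ then 1 else 0, 0, fun ε hε => ?_⟩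
    simp [ite_and, triSum]
    grind
  · refine ⟨0, 0, fun ε hε => ?_⟩
    simp [ite_and, triSum, Finset.sum_add_distrib]
  · refine ⟨if a₁ = b₁ ∧ b₁ = c₁ ∧ a₃ = b₂ ∧ a₂ = c₂ ∧ a₃ = c₃ then 1 else 0, 0, fun ε hε => ?_⟩
    simp [ite_and, triSum]
    split_ifs <;> grind
  · refine ⟨0, 0, fun ε hε => ?_⟩
    simp [ite_and, triSum, Finset.sum_add_distrib]
    split_ifs <;> grind
  · refine ⟨0, if a₁ = b₁ ∧ b₁ = c₁ ∧ a₂ = b₂ ∧ b₂ = c₂ ∧ a₃ = b₃ ∧ b₃ = c₃ then 1 else 0,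
      fun ε hε => ?_⟩
    simp [ite_and, triSum]
    split_ifs <;> grind
  · refine ⟨0, 0, fun ε hε => ?_⟩
    simp [ite_and, triSum, innerTensor]
    split_ifs <;> grind

theorem triBorderLE_schonhage {J : Type} [Fintype J] [DecidableEq J] (n : ℕ) :
    TriBorderLE (triSum J (outerTensor n) (innerTensor (J × Fin n × Fin n)))
      (Fintype.card J * (n + 1) ^ 2) := by
  choose x y hxy using exists_schonhage_error (J := J) n
  let S : ℂ → (J × Fin n) ⊕ (J × Fin n × Fin n) → (J × Fin n) ⊕ (J × Fin n × Fin n) →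
      (J × Fin n × Fin n) ⊕ Unit → ℂ := fun ε a b c =>
    triSum J (outerTensor n) (innerTensor (J × Fin n × Fin n)) a b c + ε * x a b c
      + ε ^ 2 * y a b c
  have hS : Continuous S := by fun_prop
  have h0 : S 0 = triSum J (outerTensor n) (innerTensor (J × Fin n × Fin n)) := by
    funext a b c
    simp [S]
  refine mem_closure_of_tendsto (b := nhdsWithin 0 {0}ᶜ)
    (h0 ▸ (hS.tendsto 0).mono_left nhdsWithin_le_nhds) ?_
  filter_upwards [self_mem_nhdsWithin] with ε hε
  convert TriRankLE.of_card_le (J := J × Option (Fin n) × Option (Fin n))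
    (r := Fintype.card J * (n + 1) ^ 2) (by simp [sq])
    (fun j => schonhageU ε j.1 j.2.1 j.2.2) (fun j => schonhageV ε j.1 j.2.1 j.2.2)
    (fun j => schonhageW ε j.1 j.2.1 j.2.2) using 1
  funext a b c
  exact (hxy a b c ε hε).symm

theorem HasRankLE.prod_mul {k : ℕ} {ι : Fin k → Type} {T : Tensor ι} {r : ℕ}
    (hT : HasRankLE T r) (g : ∀ i, ι i → ℂ) : HasRankLE (fun x => (∏ i, g i (x i)) * T x) r := by
  obtain ⟨v, rfl⟩ := hT
  exact ⟨fun j i y => g i y * v j i y, by simp [Finset.mul_sum, Finset.prod_mul_distrib]⟩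

theorem HasRankLE.add {k : ℕ} {ι : Fin k → Type} {T S : Tensor ι} {r s : ℕ}
    (hT : HasRankLE T r) (hS : HasRankLE S s) : HasRankLE (T + S) (r + s) := by
  obtain ⟨v, rfl⟩ := hT
  obtain ⟨w, rfl⟩ := hS
  exact ⟨Fin.append v w, by funext x; simp [Fin.sum_univ_add]⟩

theorem HasBorderRankLE.prod_mul {k : ℕ} {ι : Fin k → Type} {T : Tensor ι} {r : ℕ}
    (hT : HasBorderRankLE T r) (g : ∀ i, ι i → ℂ) :
    HasBorderRankLE (fun x => (∏ i, g i (x i)) * T x) r :=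
  map_mem_closure (f := fun (T : Tensor ι) x => (∏ i, g i (x i)) * T x) (by fun_prop) hT
    fun _ hS => hS.prod_mul g

theorem HasBorderRankLE.add {k : ℕ} {ι : Fin k → Type} {T S : Tensor ι} {r s : ℕ}
    (hT : HasBorderRankLE T r) (hS : HasBorderRankLE S s) : HasBorderRankLE (T + S) (r + s) :=
  map_mem_closure₂ continuous_add hT hS fun _ hT _ hS => hT.add hS

theorem HasBorderRankLE.sum {k : ℕ} {ι : Fin k → Type} {I : Type} (s : Finset I)
    {T : I → Tensor ι} {r : ℕ} (hT : ∀ i, HasBorderRankLE (T i) r) :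
    HasBorderRankLE (∑ i ∈ s, T i) (s.card * r) := by
  classical
  induction s using Finset.induction_on with
  | empty =>
    have h0 : HasRankLE (0 : Tensor ι) 0 := ⟨nofun, by funext x; simp⟩
    rw [sum_empty, card_empty, zero_mul]
    exact subset_closure h0
  | insert i s hi ih =>
    rw [sum_insert hi, card_insert_of_notMem hi, add_mul, one_mul, add_comm _ r]
    exact (hT i).add ih

theorem prod_update_one {k : ℕ} {ι : Fin k → Type} (i : Fin k) (F : ι i → ℂ) (x : ∀ i, ι i) :
    ∏ i', Function.update (fun _ _ => 1 : ∀ i, ι i → ℂ) i F i' (x i') = F (x i) := by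
  rw [Finset.prod_eq_single i]
  · simp
  · intro j _ hj
    simp [hj]
  · simp

theorem TriBorderLE.hasBorderRankLE {α β γ : Type} {M : α → β → γ → ℂ} {r : ℕ}
    (hM : TriBorderLE M r) {k : ℕ} {ι : Fin k → Type} (i₀ i₁ i₂ : Fin k)
    (f : ι i₀ → α) (g : ι i₁ → β) (h : ι i₂ → γ) :
    HasBorderRankLE (fun x : ∀ i, ι i => M (f (x i₀)) (g (x i₁)) (h (x i₂))) r := by
  refine map_mem_closure (f := fun (M : α → β → γ → ℂ) (x : ∀ i, ι i) =>
    M (f (x i₀)) (g (x i₁)) (h (x i₂))) (by fun_prop) hM ?_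
  rintro _ ⟨u, v, w, rfl⟩
  refine ⟨fun j i y => Function.update (fun _ _ => 1 : ∀ i, ι i → ℂ) i₀ (fun y => u j (f y)) i y *
    Function.update (fun _ _ => 1 : ∀ i, ι i → ℂ) i₁ (fun y => v j (g y)) i y *
    Function.update (fun _ _ => 1 : ∀ i, ι i → ℂ) i₂ (fun y => w j (h y)) i y, ?_⟩
  funext x
  simp only [Finset.prod_mul_distrib, prod_update_one]

/-- The simple factors fixing the coordinates of the spider on its legs `2, …, d - 1`. -/
def legWeight {e n Q m l : ℕ} (s : Fin m → Fin e → Fin n) (i : Fin (e + 2 + 1))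
    (y : (Fin m → famV n (e + 2) i) × (Fin l → famW Q (e + 2) i)) : ℂ :=
  if h : (i : ℕ) < e + 2 then
    if h₂ : 2 ≤ (i : ℕ) then ∏ j, delta (vlow h (y.1 j)) (s j ⟨i - 2, by omega⟩) else 1
  else ∏ j, ∏ k : Fin e, delta (s j k) (vhigh h (y.1 j) k.succ.succ)

theorem prod_legWeight {e n Q m l : ℕ} (s : Fin m → Fin e → Fin n)
    (x : ∀ i, (Fin m → famV n (e + 2) i) × (Fin l → famW Q (e + 2) i)) :
    ∏ i, legWeight s i (x i) =
      (∏ k : Fin e, ∏ j, delta (vlow (i := Fin.castSucc k.succ.succ) (by simp)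
        ((x (Fin.castSucc k.succ.succ)).1 j)) (s j k)) *
      ∏ j, ∏ k : Fin e, delta (s j k)
        (vhigh (i := Fin.last (e + 2)) (by simp) ((x (Fin.last (e + 2))).1 j) k.succ.succ) := by
  rw [Fin.prod_univ_castSucc, Fin.prod_univ_succ, Fin.prod_univ_succ]
  simp [legWeight]

theorem TriBorderLE.spider_kron {e n Q m l r : ℕ} (hd : 1 ≤ e + 2)
    (h : TriBorderLE (mixedPow (outerTensor n) (innerTensor (Fin Q)) m l) r) :
    HasBorderRankLE (kron (kpow (bigSpider n (e + 2)) m) (kpow (bigMat Q (e + 2) hd) l))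
      ((n ^ e) ^ m * r) := by
  have key := HasBorderRankLE.sum (univ : Finset (Fin m → Fin e → Fin n)) fun s =>
    (h.hasBorderRankLE (ι := fun i => (Fin m → famV n (e + 2) i) × (Fin l → famW Q (e + 2) i))
      (Fin.castSucc (0 : Fin (e + 2))) (Fin.castSucc (Fin.succ (0 : Fin (e + 1))))
      (Fin.last (e + 2))
      (fun y => (fun j => vlow (by simp) (y.1 j), fun j => wlow (by simp) (y.2 j)))
      (fun y => (fun j => vlow (by simp) (y.1 j), fun j => wlow (by simp) (y.2 j)))
      (fun y => (fun j => (vhigh (by simp) (y.1 j) 0, vhigh (by simp) (y.1 j) 1),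
        fun _ => ()))).prod_mul (legWeight s)
  convert key using 1
  · funext x
    rw [Finset.sum_apply, Finset.sum_eq_single fun j k =>
      vhigh (i := Fin.last (e + 2)) (by simp) ((x (Fin.last (e + 2))).1 j) k.succ.succ]
    · rw [prod_legWeight, Finset.prod_comm]
      have hB : ∀ z, bigMat Q (e + 2) hd z = innerTensor (Fin Q)
          (wlow (i := Fin.castSucc (0 : Fin (e + 2))) (by simp) (z _))
          (wlow (i := Fin.castSucc (Fin.succ (0 : Fin (e + 1)))) (by simp) (z _)) () :=
        fun z => rfl
      have hA : ∀ (a b : Fin n) c, outerTensor n a b c = delta a c.1 * delta b c.2 := by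
        intro a b c
        by_cases h₁ : a = c.1 <;> by_cases h₂ : b = c.2 <;> simp [outerTensor, delta, h₁, h₂]
      have hone : ∀ a : Fin n, delta a a = 1 := fun a => if_pos rfl
      simp only [kron, kpow, hB, bigSpider, mixedPow, hA, hone, Fin.prod_univ_succ,
        Finset.prod_mul_distrib, Finset.prod_const_one, mul_one, Fin.succ_zero_eq_one]
      ring
    · intro s _ hs
      obtain ⟨j, hj⟩ := Function.ne_iff.1 hs
      obtain ⟨k, hk⟩ := Function.ne_iff.1 hj
      rw [prod_legWeight, Finset.prod_eq_zero (mem_univ j)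
        (Finset.prod_eq_zero (mem_univ k) (if_neg hk)), mul_zero, zero_mul]
    · simp
  · simp

section Asymptotics

open Filter Topology

theorem tendsto_log_factorial_div :
    Tendsto (fun n : ℕ => Real.log (n.factorial : ℝ) / n - Real.log n) atTop (𝓝 (-1)) := by
  have h1 : Tendsto (fun n : ℕ => Real.log (Stirling.stirlingSeq n) * (n : ℝ)⁻¹) atTop (𝓝 0) := by
    have := ((Real.continuousAt_log (by positivity)).tendsto.comp
      Stirling.tendsto_stirlingSeq_sqrt_pi).mul (tendsto_inv_atTop_nhds_zero_nat (𝕜 := ℝ))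
    simpa using this
  have h2 : Tendsto (fun n : ℕ => Real.log (2 * n) / (2 * n)) atTop (𝓝 0) := by
    have h := Real.isLittleO_log_id_atTop.tendsto_div_nhds_zero
    exact h.comp (tendsto_natCast_atTop_atTop.const_mul_atTop (by norm_num : (0 : ℝ) < 2))
  have h3 := (h1.add h2).add_const (-1)
  simp only [add_zero, zero_add] at h3
  refine h3.congr' ?_
  filter_upwards [eventually_gt_atTop 0] with n hn
  have hn' : (n : ℝ) ≠ 0 := by positivity
  rw [Stirling.log_stirlingSeq_formula, Real.log_div hn' (Real.exp_ne_zero _), Real.log_exp]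
  field_simp
  ring

theorem tendsto_log_factorial_mul_div {a : ℕ} (ha : 0 < a) :
    Tendsto (fun k : ℕ => Real.log ((a * k).factorial : ℝ) / k - a * Real.log k) atTop
      (𝓝 (a * Real.log a - a)) := by
  have h := ((tendsto_log_factorial_div.comp
    (tendsto_id.const_mul_atTop' ha)).const_mul (a : ℝ)).add_const (a * Real.log a)
  rw [show (a : ℝ) * Real.log a - a = a * -1 + a * Real.log a by ring]
  refine h.congr' ?_
  filter_upwards [eventually_gt_atTop 0] with k hk
  have hk' : (k : ℝ) ≠ 0 := by positivity
  have ha' : (a : ℝ) ≠ 0 := by positivity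
  simp only [Function.comp, id, Nat.cast_mul, Real.log_mul ha' hk']
  field_simp
  ring

theorem tendsto_log_choose_div {a b : ℕ} (ha : 0 < a) (hb : 0 < b) :
    Tendsto (fun k : ℕ => Real.log ((a * k + b * k).choose (a * k) : ℝ) / k) atTop
      (𝓝 ((a + b) * Real.log (a + b) - a * Real.log a - b * Real.log b)) := by
  have h := ((tendsto_log_factorial_mul_div (Nat.add_pos_left ha b)).sub
    (tendsto_log_factorial_mul_div ha)).sub (tendsto_log_factorial_mul_div hb)
  push_cast at h
  convert h using 1
  · funext k
    rw [Nat.cast_add_choose, Real.log_div (by positivity) (by positivity),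
      Real.log_mul (by positivity) (by positivity), add_mul]
    ring
  · ring_nf

theorem eventually_rpow_lt {a b c R : ℕ} (ha : 0 < a) (hb : 0 < b) (hc : 0 < c)
    (hR : c + 1 ≤ R) (ρ : ℕ → ℕ) (hadd : ∀ k k', ρ (k + k') ≤ ρ k * ρ k')
    (hρ : ∀ k M q, R ^ (a * k + b * k) ≤ q * ((a * k + b * k).choose (a * k) * c ^ (a * k)) →
      ρ (k * M) ≤ q ^ M * ((a * k + b * k).choose (a * k) * c ^ (a * k)))
    {Y : ℝ} (hY : Real.exp (Real.log R -
      ((a + b) * Real.log (a + b) - a * Real.log a - b * Real.log b) / (a + b)) < Y) :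
    ∀ᶠ k : ℕ in atTop, ((c ^ (a * k) * ρ k : ℕ) : ℝ) ^ ((1 : ℝ) / (a * k + b * k)) < Y := by
  set H : ℝ := (a + b) * Real.log (a + b) - a * Real.log a - b * Real.log b with hH
  let C : ℕ → ℕ := fun k => (a * k + b * k).choose (a * k) * c ^ (a * k)
  have hCpos : ∀ k, 0 < C k := fun k =>
    Nat.mul_pos (Nat.choose_pos (Nat.le_add_right _ _)) (by positivity)
  have hCR : ∀ k, C k ≤ R ^ (a * k + b * k) := by
    intro k
    refine le_trans ?_ (Nat.pow_le_pow_left hR _)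
    rw [add_pow]
    refine le_trans (le_of_eq ?_) (Finset.single_le_sum (fun _ _ => Nat.zero_le _)
      (Finset.mem_range.2 (Nat.lt_succ_of_le (Nat.le_add_right (a * k) (b * k)))))
    simp [C, mul_comm]
  have hRn : 0 < R := by omega
  have hlog : ∀ {x y : ℕ}, 0 < y → x ≤ y → Real.log x ≤ Real.log y := by
    intro x y hy hxy
    rcases Nat.eq_zero_or_pos x with rfl | hx
    · simpa using Real.log_natCast_nonneg y
    · exact Real.log_le_log (by exact_mod_cast hx) (by exact_mod_cast hxy)
  have hu : Subadditive fun k => Real.log (ρ k) := by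
    intro k k'
    rcases Nat.eq_zero_or_pos (ρ k * ρ k') with h0 | h0
    · have : ρ (k + k') = 0 := by have := hadd k k'; omega
      simpa [this] using add_nonneg (Real.log_natCast_nonneg (ρ k)) (Real.log_natCast_nonneg (ρ k'))
    · have := hlog h0 (hadd k k')
      rwa [Nat.cast_mul, Real.log_mul] at this
      · exact_mod_cast (pos_of_mul_pos_left h0 (Nat.zero_le _)).ne'
      · exact_mod_cast (pos_of_mul_pos_right h0 (Nat.zero_le _)).ne'
  have hbdd : BddBelow (Set.range fun n : ℕ => Real.log (ρ n) / n) :=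
    ⟨0, by rintro _ ⟨n, rfl⟩; exact div_nonneg (Real.log_natCast_nonneg _) n.cast_nonneg⟩
  have hlim₁ : ∀ k, 0 < k → hu.lim ≤
      (Real.log 2 + (a + b) * k * Real.log R - Real.log (C k)) / k := by
    intro k hk
    have hk' : (0 : ℝ) < k := by exact_mod_cast hk
    set q := R ^ (a * k + b * k) / C k + 1 with hq
    have hqC : R ^ (a * k + b * k) ≤ q * C k := by
      rw [hq]
      exact (Nat.lt_mul_div_succ _ (hCpos k)).le.trans_eq (mul_comm _ _)
    have hq0 : 0 < q := Nat.succ_pos _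
    have hC' : (0 : ℝ) < C k := by exact_mod_cast hCpos k
    have hqle : Real.log q ≤ Real.log 2 + (a + b) * k * Real.log R - Real.log (C k) := by
      have h1 : q * C k ≤ 2 * R ^ (a * k + b * k) := by
        rw [hq, add_mul, one_mul, two_mul]
        exact add_le_add (Nat.div_mul_le_self _ _) (hCR k)
      have h2 := hlog (Nat.mul_pos two_pos (pow_pos hRn _)) h1
      push_cast at h2
      rw [Real.log_mul (by positivity) hC'.ne', Real.log_mul (by norm_num) (by positivity),
        Real.log_pow] at h2
      push_cast at h2
      linarith
    have hM : ∀ M : ℕ, 0 < M → hu.lim ≤ Real.log (C k) / k * (M : ℝ)⁻¹ + Real.log q / k := by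
      intro M hM
      have hM' : (0 : ℝ) < M := by exact_mod_cast hM
      refine (hu.lim_le_div hbdd (Nat.mul_pos hk hM).ne').trans ?_
      have h1 := hlog (Nat.mul_pos (pow_pos hq0 _) (hCpos k)) (hρ k M q hqC)
      rw [Nat.cast_mul, Real.log_mul (by positivity) hC'.ne', Nat.cast_pow, Real.log_pow] at h1
      calc _ ≤ (M * Real.log q + Real.log (C k)) / ((k * M : ℕ) : ℝ) := by gcongr
        _ = _ := by push_cast; field_simp; ring
    have hten : Tendsto (fun M : ℕ => Real.log (C k) / k * (M : ℝ)⁻¹ + Real.log q / k) atTop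
        (𝓝 (Real.log q / k)) := by
      simpa using ((tendsto_inv_atTop_nhds_zero_nat (𝕜 := ℝ)).const_mul
        (Real.log (C k) / k)).add_const (Real.log q / k)
    refine (ge_of_tendsto hten ?_).trans (by gcongr)
    filter_upwards [eventually_gt_atTop 0] with M h using hM M h
  have hlim₂ : hu.lim ≤ (a + b) * Real.log R - a * Real.log c - H := by
    have h := ((((tendsto_inv_atTop_nhds_zero_nat (𝕜 := ℝ)).const_mul (Real.log 2)).add_const
      ((a + b) * Real.log R - a * Real.log c)).sub (tendsto_log_choose_div ha hb))
    rw [mul_zero, zero_add] at h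
    refine ge_of_tendsto h ?_
    filter_upwards [eventually_gt_atTop 0] with k hk
    refine (hlim₁ k hk).trans (le_of_eq ?_)
    have hk' : (k : ℝ) ≠ 0 := by positivity
    have hch : ((a * k + b * k).choose (a * k) : ℝ) ≠ 0 := by
      exact_mod_cast (Nat.choose_pos (Nat.le_add_right _ _)).ne'
    simp only [C, Nat.cast_mul, Nat.cast_pow]
    rw [Real.log_mul hch (by positivity), Real.log_pow]
    push_cast
    field_simp
    ring
  have hab : (0 : ℝ) < a + b := by positivity
  have hten : Tendsto (fun k : ℕ => Real.exp ((a * Real.log c + Real.log (ρ k) / k) / (a + b)))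
      atTop (𝓝 (Real.exp ((a * Real.log c + hu.lim) / (a + b)))) :=
    (Real.continuous_exp.tendsto _).comp
      (((hu.tendsto_lim hbdd).const_add _).div_const _)
  have hlt : Real.exp ((a * Real.log c + hu.lim) / (a + b)) < Y := by
    refine lt_of_le_of_lt (Real.exp_le_exp.2 ?_) hY
    rw [div_le_iff₀ hab, sub_mul, div_mul_cancel₀ _ hab.ne']
    linarith
  filter_upwards [hten.eventually_lt_const hlt, eventually_gt_atTop 0] with k hk hk0
  have hk' : (k : ℝ) ≠ 0 := by positivity
  rcases Nat.eq_zero_or_pos (ρ k) with h0 | h0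
  · rw [h0, mul_zero, Nat.cast_zero, Real.zero_rpow (by positivity)]
    exact (Real.exp_pos _).trans hY
  · refine lt_of_eq_of_lt ?_ hk
    rw [Real.rpow_def_of_pos (by positivity)]
    push_cast
    rw [Real.log_mul (by positivity) (by positivity), Real.log_pow]
    push_cast
    congr 1
    field_simp

end Asymptotics

theorem triBorderLE_triSum_fin (e n : ℕ) :
    TriBorderLE (triSum (Fin e → Fin n) (outerTensor n) (innerTensor (Fin (n ^ (e + 2)))))
      (n ^ e * (n + 1) ^ 2) := by
  let σ : Fin (n ^ (e + 2)) ≃ (Fin e → Fin n) × Fin n × Fin n :=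
    Fintype.equivOfCardEq (by simp; ring)
  have h := (triBorderLE_schonhage (J := Fin e → Fin n) n).pullback
    (Sum.map id σ) (Sum.map id σ) id
  rw [Fintype.card_fun, Fintype.card_fin, Fintype.card_fin] at h
  convert h using 1
  funext a b c
  rcases a with a | a <;> rcases b with b | b <;> rcases c with c | c <;>
    simp [triSum, innerTensor]

theorem exists_submultiplicative_bound {n e R : ℕ} (hn : 1 ≤ n) (hd : 1 ≤ e + 2)
    (hR : n ^ e * (n + 1) ^ 2 ≤ R) (a b : ℕ) :
    ∃ ρ : ℕ → ℕ, (∀ k k', ρ (k + k') ≤ ρ k * ρ k') ∧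
      (∀ k M q,
        R ^ (a * k + b * k) ≤ q * ((a * k + b * k).choose (a * k) * (n ^ e) ^ (a * k)) →
        ρ (k * M) ≤ q ^ M * ((a * k + b * k).choose (a * k) * (n ^ e) ^ (a * k))) ∧
      ∀ k, borderRank (kron (kpow (bigSpider n (e + 2)) (a * k))
        (kpow (bigMat (n ^ (e + 2)) (e + 2) hd) (b * k))) ≤ (n ^ e) ^ (a * k) * ρ k := by
  have : Nonempty (Fin n) := ⟨⟨0, hn⟩⟩
  let t₁ := outerTensor n
  let t₂ := innerTensor (Fin (n ^ (e + 2)))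
  have hcopies := ((triBorderLE_triSum_fin e n).mono hR).copies_mixedPow
  have hne : ∀ m l : ℕ, Nonempty
      ({S : Finset (Fin (m + l)) // S.card = m} × (Fin m → Fin e → Fin n)) := by
    intro m l
    have : Nonempty {S : Finset (Fin (m + l)) // S.card = m} := by
      rw [← Fintype.card_pos_iff, Fintype.card_finset_len, Fintype.card_fin]
      exact Nat.choose_pos (Nat.le_add_right _ _)
    infer_instance
  have hcard : ∀ m l : ℕ, Fintype.card
      ({S : Finset (Fin (m + l)) // S.card = m} × (Fin m → Fin e → Fin n)) =
        (m + l).choose m * (n ^ e) ^ m := by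
    intro m l
    rw [Fintype.card_prod, Fintype.card_finset_len]
    simp
  let A : ℕ → Set ℕ := fun k => {r | TriBorderLE (mixedPow t₁ t₂ (a * k) (b * k)) r}
  have hmem : ∀ k, sInf (A k) ∈ A k := by
    intro k
    have := hne (a * k) (b * k)
    exact Nat.sInf_mem ⟨_, (hcopies (a * k) (b * k)).of_copies⟩
  refine ⟨fun k => sInf (A k), fun k k' => Nat.sInf_le ?_, fun k M q hq => Nat.sInf_le ?_,
    fun k => Nat.sInf_le ((hmem k).spider_kron hd)⟩
  · change TriBorderLE _ _
    rw [mul_add, mul_add, mixedPow_add]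
    exact ((hmem k).kronecker (hmem k')).pullback _ _ _
  · have := hne (a * k) (b * k)
    have h := ((hcopies (a * k) (b * k)).copies_mixedPow_mul (q := q)
      (by rwa [hcard]) M).of_copies
    rw [hcard, mul_assoc, mul_assoc] at h
    exact h

theorem pow_mul_succ_sq_le {n e : ℕ} (he : 1 ≤ e) :
    n ^ e * (n + 1) ^ 2 ≤
      n ^ (e + 2) + 2 * n ^ (e + 1) + n ^ 2 * (n + 1) ^ (e - 1) + 1 := by
  obtain ⟨e, rfl⟩ := Nat.exists_eq_add_of_le' he
  rw [Nat.add_sub_cancel]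
  rcases Nat.eq_zero_or_pos e with rfl | h0
  · ring_nf
    nlinarith [sq_nonneg (n : ℤ), Nat.le_self_pow two_ne_zero n]
  · have h1 : n ^ (e + 1) ≤ n ^ 2 * (n + 1) ^ (e - 1) := by
      obtain ⟨e, rfl⟩ := Nat.exists_eq_add_of_le' h0
      rw [Nat.add_sub_cancel, add_assoc, pow_add, mul_comm]
      exact Nat.mul_le_mul_left _ (Nat.pow_le_pow_left n.le_succ _)
    have h2 : n ^ 2 * (n + 1) ^ (e - 1) ≤ n ^ 2 * (n + 1) ^ e := by
      gcongr <;> omega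
    calc n ^ (e + 1) * (n + 1) ^ 2
        = n ^ (e + 1 + 2) + 2 * n ^ (e + 1 + 1) + n ^ (e + 1) := by ring
      _ ≤ _ := by omega

theorem mul_two_rpow_neg_binEnt {a b : ℕ} (ha : 0 < a) (hb : 0 < b) {R : ℕ} (hR : 0 < R) {p : ℚ}
    (hp : p = a / ((a + b : ℕ) : ℚ)) :
    (R : ℝ) * 2 ^ (-binEnt p) = Real.exp (Real.log R -
      ((a + b) * Real.log (a + b) - a * Real.log a - b * Real.log b) / (a + b)) := by
  have hp' : (p : ℝ) = a / (a + b) := by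
    rw [hp]
    push_cast
    rfl
  have ha' : (0 : ℝ) < a := by exact_mod_cast ha
  have hb' : (0 : ℝ) < b := by exact_mod_cast hb
  have hq : 1 - (a : ℝ) / (a + b) = b / (a + b) := by field_simp; ring
  have hlog2 : Real.log 2 ≠ 0 := (Real.log_pos one_lt_two).ne'
  rw [Real.rpow_def_of_pos two_pos, sub_eq_add_neg, Real.exp_add,
    Real.exp_log (by exact_mod_cast hR)]
  congr 2
  rw [binEnt, hp', hq, Real.logb, Real.logb, Real.log_div (by positivity) (by positivity),
    Real.log_div (by positivity) (by positivity)]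
  field_simp
  ring

theorem exists_pos_add_of_rat {p : ℚ} (hp0 : 0 < p) (hp1 : p < 1) :
    ∃ a b : ℕ, 0 < a ∧ 0 < b ∧ p = a / ((a + b : ℕ) : ℚ) ∧
      ∀ N : ℕ, (∃ m : ℕ, (m : ℚ) = p * N) →
        ∃ k : ℕ, N = (a + b) * k ∧ (p * N).num.toNat = a * k := by
  have hnum : 0 < p.num := Rat.num_pos.2 hp0
  have hlt : p.num < p.den := by simpa using (Rat.lt_iff _ _).1 hp1
  obtain ⟨a, ha⟩ := Int.eq_ofNat_of_zero_le hnum.le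
  have hab : a + (p.den - a) = p.den := by omega
  have hp : p = a / (p.den : ℚ) := by
    conv_lhs => rw [← Rat.num_div_den p, ha]
    rfl
  refine ⟨a, p.den - a, by omega, by omega, by rwa [hab], ?_⟩
  rintro N ⟨m, hm⟩
  have h1 : m * p.den = a * N := by
    have : (m * p.den : ℚ) = a * N := by
      rw [hm, mul_right_comm, Rat.mul_den_eq_num, ha]
      rfl
    exact_mod_cast this
  have hcop : Nat.Coprime p.den a := by
    have := p.reduced
    rw [ha] at this
    exact this.symm
  obtain ⟨k, rfl⟩ : p.den ∣ N := hcop.dvd_of_dvd_mul_left ⟨m, by rw [← h1, mul_comm]⟩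
  refine ⟨k, by rw [hab], ?_⟩
  have h2 : m = a * k := Nat.eq_of_mul_eq_mul_right p.den_pos (by rw [h1]; ring)
  rw [← hm, h2, Rat.num_natCast, Int.toNat_natCast]

/-- Theorem 4.2: exponent of the multi-extended matrix multiplication
tensor. For `n ≥ 1`, `d ≥ 3` and rational `p ∈ (0,1)`, the limit superior, over
integers `N → ∞` with `pN ∈ ℕ`, of `R̲(T₁^{⊠pN} ⊠ T₂^{⊠(1−p)N})^{1/N}` is at most
`(n^d + 2n^{d−1} + n²(n+1)^{d−3} + 1) · 2^{−h(p)}`. -/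
theorem exponent_multiEMaMu (n d : ℕ) (hn : 1 ≤ n) (hd : 3 ≤ d)
    (p : ℚ) (hp0 : 0 < p) (hp1 : p < 1) :
    Filter.limsup
      (fun N : ℕ =>
        ((borderRank (kron (kpow (bigSpider n d) (p * (N : ℚ)).num.toNat)
            (kpow (bigMat (n ^ d) d (by omega)) (N - (p * (N : ℚ)).num.toNat))) : ℝ))
          ^ ((1 : ℝ) / (N : ℝ)))
      (pIntFilter p) ≤
      ((n ^ d + 2 * n ^ (d - 1) + n ^ 2 * (n + 1) ^ (d - 3) + 1 : ℕ) : ℝ) *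
        (2 : ℝ) ^ (-binEnt p) := by
  obtain ⟨e, rfl⟩ := Nat.exists_eq_add_of_le' (show 2 ≤ d by omega)
  have he : 1 ≤ e := by omega
  obtain ⟨a, b, ha, hb, hp, hN⟩ := exists_pos_add_of_rat hp0 hp1
  set R := n ^ (e + 2) + 2 * n ^ (e + 2 - 1) + n ^ 2 * (n + 1) ^ (e + 2 - 3) + 1 with hRdef
  have hR : n ^ e * (n + 1) ^ 2 ≤ R := pow_mul_succ_sq_le he
  have hc : 0 < n ^ e := pow_pos hn e
  have hcR : n ^ e + 1 ≤ R := by nlinarith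
  obtain ⟨ρ, hadd, hρ, hbound⟩ :=
    exists_submultiplicative_bound hn (by omega : 1 ≤ e + 2) hR a b
  have : (pIntFilter p).NeBot := by
    rw [pIntFilter, ← Filter.frequently_mem_iff_neBot]
    refine Filter.frequently_atTop.2 fun N => ⟨(a + b) * N, Nat.le_mul_of_pos_left N (by omega),
      a * N, ?_⟩
    rw [hp]
    have : ((a + b : ℕ) : ℚ) ≠ 0 := by positivity
    push_cast at this ⊢
    field_simp
  rw [mul_two_rpow_neg_binEnt ha hb (by omega) hp]
  refine le_of_forall_gt fun Y hY => ?_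
  obtain ⟨Z, hZ, hZY⟩ := exists_between hY
  refine lt_of_le_of_lt (Filter.limsup_le_of_le
    (Filter.isCoboundedUnder_le_of_le _ (x := 0) fun N => by positivity) ?_) hZY
  obtain ⟨k₀, hk₀⟩ := Filter.eventually_atTop.1 (eventually_rpow_lt ha hb hc hcR ρ hadd hρ hZ)
  rw [pIntFilter, Filter.eventually_inf_principal]
  filter_upwards [Filter.eventually_ge_atTop ((a + b) * k₀)] with N hNk hNp
  obtain ⟨k, rfl, hk⟩ := hN N hNp
  have hsub : (a + b) * k - a * k = b * k := by rw [add_mul, Nat.add_sub_cancel_left]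
  rw [hk, hsub]
  have hcast : (((a + b) * k : ℕ) : ℝ) = a * k + b * k := by push_cast; ring
  rw [hcast]
  refine le_trans ?_ (hk₀ k (Nat.le_of_mul_le_mul_left hNk (by omega))).le
  gcongr
  exact hbound k

end
end Subadditivity
end
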